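/- arXiv:math/0212318 — 3 statements merged into one kernel-verified Lean document; each statement's English description precedes it below -/
import Mathlib

section
/- Let m = (m₁,…,m_k) be positive integers summing to n. For every λ = (λ₁,…,λ_k) ∈ ℂ^k, setting μ_i = λ_i − (m₁+…+m_{i−1})·t ∈ ℂ[t] for i = 1,…,k, every entry of the n×n matrix (E−μ₁)(E−μ₂)…(E−μ_k) lies in the annihilator J_{p_t,λ} of the generalized Verma module V_{p_t,λ}. -/
noncomputable section

open Polynomial MulOpposite

abbrev Ct : Type := Polynomial ℂ

abbrev FA (n : ℕ) : Type := FreeAlgebra Ct (Fin n × Fin n)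

/-- The defining relations of `U(g_t)`. -/
inductive glRel (n : ℕ) : FA n → FA n → Prop
  | comm (i j l m : Fin n) :
      glRel n
        (FreeAlgebra.ι Ct ((i, j) : Fin n × Fin n) * FreeAlgebra.ι Ct ((m, l) : Fin n × Fin n)
          - FreeAlgebra.ι Ct ((m, l) : Fin n × Fin n) * FreeAlgebra.ι Ct ((i, j) : Fin n × Fin n))
        ((X : Ct) • ((if j = m then (1 : Ct) else 0) • FreeAlgebra.ι Ct ((i, l) : Fin n × Fin n)
          - (if i = l then (1 : Ct) else 0) • FreeAlgebra.ι Ct ((m, j) : Fin n × Fin n)))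

/-- `U(g_t)`. -/
abbrev Ugt (n : ℕ) : Type := RingQuot (glRel n)

/-- The generator `E^i_j`. -/
def Egen (n : ℕ) (i j : Fin n) : Ugt n :=
  RingQuot.mkAlgHom Ct (glRel n) (FreeAlgebra.ι Ct (i, j))

/-- The matrix `E` with entries in the opposite algebra (used for the "paper" product
convention). -/
def EmatOp (n : ℕ) : Matrix (Fin n) (Fin n) (Ugt n)ᵐᵒᵖ :=
  Matrix.of fun i j => op (Egen n i j)

/-- The matrix `E`. -/
def Emat (n : ℕ) : Matrix (Fin n) (Fin n) (Ugt n) :=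
  Matrix.of fun i j => Egen n i j

/-- Entries of `(E-μ₁)⋯(E-μ_k)` in the paper's convention
`(E^ℓ)^i_j = Σ E^{α₁}_j E^{α₂}_{α₁} ⋯ E^i_{α_{ℓ-1}}`. -/
def prodE (n k : ℕ) (μ : Fin k → Ct) : Matrix (Fin n) (Fin n) (Ugt n) :=
  Matrix.of fun i j =>
    unop (((List.ofFn fun s : Fin k =>
      EmatOp n - algebraMap Ct (Matrix (Fin n) (Fin n) (Ugt n)ᵐᵒᵖ) (μ s)).prod) i j)

/-- `Tr E^ℓ` in the paper's convention. -/
def trE (n ℓ : ℕ) : Ugt n := unop (Matrix.trace (EmatOp n ^ ℓ))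

/-- Entries of `(E-ν₁)∘⋯∘(E-ν_k)` in the opposite convention
`(E^{∘ℓ})^i_j = Σ E^i_{α₁} E^{α₁}_{α₂} ⋯ E^{α_{ℓ-1}}_j`. -/
def prodEop (n k : ℕ) (ν : Fin k → Ct) : Matrix (Fin n) (Fin n) (Ugt n) :=
  (List.ofFn fun s : Fin k =>
    Emat n - algebraMap Ct (Matrix (Fin n) (Fin n) (Ugt n)) (ν s)).prod

/-- `Tr E^{∘ℓ}`. -/
def trEop (n ℓ : ℕ) : Ugt n := Matrix.trace (Emat n ^ ℓ)

/-- `θ_ℓ(m, μ, τ)`. -/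
def theta {R : Type*} [CommRing R] {k : ℕ} (m : Fin k → ℕ) (μ : Fin k → R) (τ : R)
    (ℓ : ℕ) : R :=
  ∑ s ∈ Finset.Icc 1 k,
    if s ≤ ℓ + 1 then
      τ ^ (s - 1) *
        ∑ J ∈ Finset.powersetCard s (Finset.univ : Finset (Fin k)),
          (∏ j ∈ J, (m j : R)) *
            ∑ d ∈ J.finsuppAntidiag (ℓ + 1 - s), ∏ j ∈ J, μ j ^ d j
    else 0

/-- Generators of the two-sided ideal `I_{m,μ,t}`. -/
def genSetA (n k : ℕ) (m : Fin k → ℕ) (μ : Fin k → Ct) : Set (Ugt n) :=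
  {u | ∃ i j : Fin n, u = prodE n k μ i j} ∪
  {u | ∃ ℓ ∈ Finset.Icc 1 (k - 1), u = trE n ℓ - algebraMap Ct (Ugt n) (theta m μ X ℓ)}

/-- The two-sided ideal `I_{m,μ,t}`. -/
def IdealA (n k : ℕ) (m : Fin k → ℕ) (μ : Fin k → Ct) : TwoSidedIdeal (Ugt n) :=
  TwoSidedIdeal.span (genSetA n k m μ)

/-- The algebra `A_{m,μ,t}`, the quotient of `U(g_t)` by the two-sided ideal generated by
`genSetA`. -/
abbrev AlgA (n k : ℕ) (m : Fin k → ℕ) (μ : Fin k → Ct) : Type :=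
  RingQuot (fun a b : Ugt n => a - b ∈ genSetA n k m μ)

noncomputable instance instRingRingQuotUgt (n : ℕ) (r : Ugt n → Ugt n → Prop) :
    Ring (RingQuot r) :=
  RingQuot.instRing r

/-- The class of `u ∈ U(g_t)` in `A_{m,μ,t}`. -/
def clsA (n k : ℕ) (m : Fin k → ℕ) (μ : Fin k → Ct) (u : Ugt n) : AlgA n k m μ :=
  RingQuot.mkAlgHom Ct _ u

/-- Generators of the two-sided ideal `I°_{m,ν,t}`. -/
def genSetAop (n k : ℕ) (m : Fin k → ℕ) (ν : Fin k → Ct) : Set (Ugt n) :=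
  {u | ∃ i j : Fin n, u = prodEop n k ν i j} ∪
  {u | ∃ ℓ ∈ Finset.Icc 1 (k - 1), u = trEop n ℓ - algebraMap Ct (Ugt n) (theta m ν (-X) ℓ)}

/-- The two-sided ideal `I°_{m,ν,t}`. -/
def IdealAop (n k : ℕ) (m : Fin k → ℕ) (ν : Fin k → Ct) : TwoSidedIdeal (Ugt n) :=
  TwoSidedIdeal.span (genSetAop n k m ν)

/-- The algebra `A°_{m,ν,t}`. -/
abbrev AlgAop (n k : ℕ) (m : Fin k → ℕ) (ν : Fin k → Ct) : Type :=
  RingQuot (fun a b : Ugt n => a - b ∈ genSetAop n k m ν)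

/-- The block index (as a natural number) of `a : Fin n` for block sizes `m`. -/
def blk (k : ℕ) (m : Fin k → ℕ) (a : ℕ) : ℕ :=
  (Finset.univ.filter fun i : Fin k => ∑ j ∈ Finset.Iic i, m j ≤ a).card

/-- The parabolic subalgebra `p_t`: block upper-triangular matrices. -/
def pSet (n k : ℕ) (m : Fin k → ℕ) : Set (Matrix (Fin n) (Fin n) Ct) :=
  {x | ∀ a b : Fin n, blk k m b < blk k m a → x a b = 0}

/-- Extension of `lam : Fin k → ℂ` to `ℕ`. -/
def lamExt (k : ℕ) (lam : Fin k → ℂ) (i : ℕ) : ℂ :=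
  if h : i < k then lam ⟨i, h⟩ else 0

/-- The character `λ` of `p_t`, `x ↦ Σ_i λ_i tr(x_ii)`. -/
def pChar (n k : ℕ) (m : Fin k → ℕ) (lam : Fin k → ℂ) (x : Matrix (Fin n) (Fin n) Ct) : Ct :=
  ∑ a : Fin n, C (lamExt k lam (blk k m a)) * x a a

/-- The canonical linear map `g_t → U(g_t)`. -/
def iotaU (n : ℕ) (x : Matrix (Fin n) (Fin n) Ct) : Ugt n :=
  ∑ i : Fin n, ∑ j : Fin n, x i j • Egen n i j

/-- The left ideal `L_λ` defining the generalized Verma module. -/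
def VermaIdeal (n k : ℕ) (m : Fin k → ℕ) (lam : Fin k → ℂ) : Submodule (Ugt n) (Ugt n) :=
  Submodule.span (Ugt n)
    {u | ∃ x ∈ pSet n k m, u = iotaU n x - algebraMap Ct (Ugt n) (pChar n k m lam x)}

noncomputable instance instHasQuotientUgt (n : ℕ) :
    HasQuotient (Ugt n) (Submodule (Ugt n) (Ugt n)) := by
  with_unfolding_all exact @Submodule.hasQuotient (Ugt n) (Ugt n) _ _ Semiring.toModule

noncomputable instance instAddCommGroupQuotUgt (n : ℕ) (p : Submodule (Ugt n) (Ugt n)) :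
    AddCommGroup (Ugt n ⧸ p) := by
  with_unfolding_all exact @Submodule.Quotient.addCommGroup (Ugt n) (Ugt n) _ _ Semiring.toModule p

noncomputable instance instModuleQuotUgt (n : ℕ) (p : Submodule (Ugt n) (Ugt n)) :
    Module (Ugt n) (Ugt n ⧸ p) := by
  with_unfolding_all exact @Submodule.Quotient.module (Ugt n) (Ugt n) _ _ Semiring.toModule p

/-- The generalized Verma module `V_{p_t,λ} = U(g_t)/L_λ`. -/
abbrev Verma (n k : ℕ) (m : Fin k → ℕ) (lam : Fin k → ℂ) : Type :=
  Ugt n ⧸ VermaIdeal n k m lam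

/-- The annihilator `J_{p_t,λ}` of the generalized Verma module, as a set. -/
def annSet (n k : ℕ) (m : Fin k → ℕ) (lam : Fin k → ℂ) : Set (Ugt n) :=
  {u | ∀ v : Verma n k m lam, u • v = 0}

/-- `A` has entries which transform under commutators with the entries of `E` as matrix units. -/
def IsAdjointMatrix {ι K R : Type*} [DecidableEq ι] [CommRing K] [Ring R] [Algebra K R]
    (t : K) (E : ι → ι → R) (A : Matrix ι ι Rᵐᵒᵖ) : Prop :=
  ∀ a b i j, E a b * unop (A i j) - unop (A i j) * E a b =
    t • ((if b = i then unop (A a j) else 0) - (if a = j then unop (A i b) else 0))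

namespace IsAdjointMatrix

variable {ι K R : Type*} [DecidableEq ι] [CommRing K] [Ring R] [Algebra K R]
  {t : K} {E : ι → ι → R} {A B : Matrix ι ι Rᵐᵒᵖ}

theorem sub (hA : IsAdjointMatrix t E A) (hB : IsAdjointMatrix t E B) :
    IsAdjointMatrix t E (A - B) := by
  intro a b i j
  have h : E a b * unop ((A - B) i j) - unop ((A - B) i j) * E a b =
      (E a b * unop (A i j) - unop (A i j) * E a b) -
        (E a b * unop (B i j) - unop (B i j) * E a b) := by
    simp only [Matrix.sub_apply, unop_sub]
    noncomm_ring
  rw [h, hA, hB, ← smul_sub]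
  congr 1
  simp only [Matrix.sub_apply, unop_sub]
  split_ifs <;> abel

/-- A left ideal containing the entries of an adjoint matrix contains their right multiples
by elements of the subalgebra generated by the entries of `E`. -/
theorem mul_mem (hA : IsAdjointMatrix t E A) (L : Ideal R) (hL : ∀ i j, unop (A i j) ∈ L)
    {w : R} (hw : w ∈ Algebra.adjoin K (Set.range (Function.uncurry E))) (i j : ι) :
    unop (A i j) * w ∈ L := by
  suffices h : ∀ v : R, (∀ i j, unop (A i j) * v ∈ L) → ∀ i j, unop (A i j) * (w * v) ∈ L by
    simpa using h 1 (by simpa using hL) i j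
  induction hw using Algebra.adjoin_induction with
  | mem x hx =>
    obtain ⟨⟨a, b⟩, rfl⟩ := hx
    intro v hv i j
    have h : unop (A i j) * (E a b * v) = E a b * (unop (A i j) * v) - algebraMap K R t *
        ((if b = i then unop (A a j) * v else 0) - (if a = j then unop (A i b) * v else 0)) := by
      have h' := congrArg (· * v) (hA a b i j)
      simp only [sub_mul, ite_mul, zero_mul, Algebra.smul_def, mul_assoc] at h'
      rw [← h', sub_sub_cancel]
    simp only [Function.uncurry_apply_pair]
    rw [h]
    refine L.sub_mem (L.mul_mem_left _ (hv i j)) (L.mul_mem_left _ (L.sub_mem ?_ ?_)) <;>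
    split_ifs <;> simp [hv]
  | algebraMap r =>
    intro v hv i j
    rw [← mul_assoc, ← Algebra.commutes, mul_assoc]
    exact L.mul_mem_left _ (hv i j)
  | add x y _ _ hx hy =>
    intro v hv i j
    rw [add_mul, mul_add]
    exact L.add_mem (hx v hv i j) (hy v hv i j)
  | mul x y _ _ hx hy =>
    intro v hv i j
    rw [mul_assoc]
    exact hx _ (hy v hv) i j

variable [Fintype ι]

theorem of_algebraMap (c : K) :
    IsAdjointMatrix t E (algebraMap K (Matrix ι ι Rᵐᵒᵖ) c) := by
  intro a b i j
  have h : ∀ i j, unop (algebraMap K (Matrix ι ι Rᵐᵒᵖ) c i j) =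
      if i = j then algebraMap K R c else 0 := by
    intro i j
    rw [Matrix.algebraMap_matrix_apply]
    split_ifs <;> simp
  simp only [h]
  have h0 : E a b * (if i = j then algebraMap K R c else 0) -
      (if i = j then algebraMap K R c else 0) * E a b = 0 := by
    split_ifs
    · rw [Algebra.commutes, sub_self]
    · simp
  rw [h0]
  by_cases h1 : b = i <;> by_cases h2 : a = j <;> simp [h1, h2, eq_comm]

theorem one : IsAdjointMatrix t E (1 : Matrix ι ι Rᵐᵒᵖ) := by
  simpa using of_algebraMap (t := t) (E := E) (1 : K)

theorem mul (hA : IsAdjointMatrix t E A) (hB : IsAdjointMatrix t E B) :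
    IsAdjointMatrix t E (A * B) := by
  intro a b i j
  have hAB : ∀ i j, unop ((A * B) i j) = ∑ x, unop (B x j) * unop (A i x) := by
    intro i j
    simp [Matrix.mul_apply, Finset.unop_sum]
  have h : ∀ x, E a b * (unop (B x j) * unop (A i x)) - unop (B x j) * unop (A i x) * E a b =
      (E a b * unop (B x j) - unop (B x j) * E a b) * unop (A i x) +
        unop (B x j) * (E a b * unop (A i x) - unop (A i x) * E a b) := by
    intro x
    noncomm_ring
  simp only [hAB, Finset.mul_sum, Finset.sum_mul, ← Finset.sum_sub_distrib, h]
  simp only [hA a b, hB a b, smul_mul_assoc, mul_smul_comm, ← smul_add, ← Finset.smul_sum]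
  congr 1
  simp only [sub_mul, mul_sub, ite_mul, mul_ite, zero_mul, mul_zero, Finset.sum_add_distrib,
    Finset.sum_sub_distrib, Finset.sum_ite_eq, Finset.mem_univ, if_true]
  by_cases h1 : b = i <;> by_cases h2 : a = j <;> simp [h1, h2]
  abel

theorem list_prod (l : List (Matrix ι ι Rᵐᵒᵖ)) (h : ∀ A ∈ l, IsAdjointMatrix t E A) :
    IsAdjointMatrix t E l.prod := by
  induction l with
  | nil => exact one
  | cons A l ih =>
    rw [List.prod_cons]
    exact (h A (by simp)).mul (ih fun B hB => h B (by simp [hB]))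

theorem prod_sub_algebraMap {r : ℕ} (hA : IsAdjointMatrix t E A) (μ : Fin r → K) :
    IsAdjointMatrix t E (List.ofFn fun s => A - algebraMap K (Matrix ι ι Rᵐᵒᵖ) (μ s)).prod := by
  refine list_prod _ fun B hB => ?_
  obtain ⟨s, rfl⟩ := List.mem_ofFn.1 hB
  exact hA.sub (of_algebraMap _)

end IsAdjointMatrix

/-- Entries of the product of the `E - μ s`, over the blocks `s < r`, lie in the left ideal
of a block upper-triangular character, for rows in the first `r` blocks. -/
theorem unop_prod_mem_of_block_lt {ι K R : Type*} [Fintype ι] [DecidableEq ι] [CommRing K]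
    [Ring R] [Algebra K R] {t : K} {E : ι → ι → R} {Eop : Matrix ι ι Rᵐᵒᵖ}
    (hEop : ∀ i j, unop (Eop i j) = E i j) (hE : IsAdjointMatrix t E Eop)
    (L : Ideal R) (blk : ι → ℕ) (lam : ℕ → K)
    (hL : ∀ a c, blk a ≤ blk c → E a c - (if a = c then algebraMap K R (lam (blk a)) else 0) ∈ L)
    {r : ℕ} (μ : Fin r → K)
    (hμ : ∀ s : Fin r, lam s - μ s = (Finset.univ.filter fun a => blk a < s).card • t)
    (i j : ι) (hi : blk i < r) :
    unop ((List.ofFn fun s => Eop - algebraMap K (Matrix ι ι Rᵐᵒᵖ) (μ s)).prod i j) ∈ L := by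
  induction r generalizing i j with
  | zero => omega
  | succ r ih =>
    rw [List.ofFn_succ', List.prod_concat]
    have ih' := ih (fun s => μ s.castSucc) (fun s => hμ s.castSucc)
    set Q := (List.ofFn fun s : Fin r =>
      Eop - algebraMap K (Matrix ι ι Rᵐᵒᵖ) (μ s.castSucc)).prod with hQ
    set M := Eop - algebraMap K (Matrix ι ι Rᵐᵒᵖ) (μ (Fin.last r)) with hM
    have hQad : IsAdjointMatrix t E Q := hE.prod_sub_algebraMap _
    have hQM : Commute Q M := by
      refine Commute.list_prod_left _ _ fun A hA => ?_
      obtain ⟨s, rfl⟩ := List.mem_ofFn.1 hA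
      exact ((Commute.refl Eop).sub_right (Algebra.commutes _ _).symm).sub_left
        (Algebra.commutes _ _)
    rcases Nat.lt_succ_iff_lt_or_eq.1 hi with hi | hi
    · rw [Matrix.mul_apply, Finset.unop_sum]
      exact L.sum_mem fun x _ => L.mul_mem_left _ (ih' i x hi)
    · rw [hQM.eq, Matrix.mul_apply, Finset.unop_sum]
      have hMx : ∀ x, unop (M i x) =
          E i x - if i = x then algebraMap K R (μ (Fin.last r)) else 0 := by
        intro x
        rw [hM, Matrix.sub_apply, unop_sub, hEop, Matrix.algebraMap_matrix_apply]
        split_ifs <;> simp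
      have key : ∀ x, unop (M i x * Q x j) -
          ((if i = x then (lam r - μ (Fin.last r)) • unop (Q i j) else 0) -
            if blk x < r then t • unop (Q i j) else 0) ∈ L := by
        intro x
        rw [unop_mul, hMx]
        by_cases hx : blk x < r
        · have hix : i ≠ x := by rintro rfl; omega
          rw [if_neg hix, if_neg hix, if_pos hx]
          have h := hQad i x x j
          rw [if_pos rfl, smul_sub] at h
          have h' : unop (Q x j) * (E i x - 0) - (0 - t • unop (Q i j)) =
              E i x * unop (Q x j) + algebraMap K R t * (if i = j then unop (Q x x) else 0) := by
            rw [← Algebra.smul_def]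
            rw [sub_eq_sub_iff_add_eq_add] at h
            rw [h, sub_zero, zero_sub, sub_neg_eq_add, add_comm]
          rw [h']
          refine L.add_mem (L.mul_mem_left _ (ih' x j hx)) (L.mul_mem_left _ ?_)
          split_ifs
          · exact ih' x x hx
          · exact L.zero_mem
        · have h := L.mul_mem_left (unop (Q x j)) (hL i x (by omega))
          rw [if_neg hx]
          convert h using 1
          rw [hi]
          split_ifs with hix
          · subst hix
            rw [Algebra.smul_def, Algebra.commutes, map_sub]
            noncomm_ring
          · simp
      have hsum := L.sum_mem (t := Finset.univ) fun x _ => key x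
      rw [Finset.sum_sub_distrib, Finset.sum_sub_distrib, Finset.sum_ite_eq,
        if_pos (Finset.mem_univ _), ← Finset.sum_filter, Finset.sum_const] at hsum
      have h0 := hμ (Fin.last r)
      rw [Fin.val_last] at h0
      rw [h0, smul_assoc, sub_self, sub_zero] at hsum
      exact hsum

theorem blk_lt_iff {k : ℕ} (m : Fin k → ℕ) (a : ℕ) (i : Fin k) :
    blk k m a < i ↔ a < ∑ j ∈ Finset.Iio i, m j := by
  have hmono : ∀ p q : Fin k, p ≤ q → ∑ j ∈ Finset.Iic p, m j ≤ ∑ j ∈ Finset.Iic q, m j :=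
    fun p q h => Finset.sum_le_sum_of_subset (Finset.Iic_subset_Iic.2 h)
  constructor
  · intro h
    by_contra! hle
    refine absurd h (not_lt.2 ?_)
    have hc : (Finset.Iio i).card = (i : ℕ) := by simp
    rw [← hc]
    refine Finset.card_le_card fun p hp => ?_
    rw [Finset.mem_filter]
    refine ⟨Finset.mem_univ _, le_trans (Finset.sum_le_sum_of_subset fun q hq => ?_) hle⟩
    rw [Finset.mem_Iic] at hq
    rw [Finset.mem_Iio] at hp ⊢
    exact hq.trans_lt hp
  · intro h
    have hi : 0 < (i : ℕ) := by
      rcases Nat.eq_zero_or_pos (i : ℕ) with h0 | h0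
      · exfalso
        have : Finset.Iio i = ∅ := by
          ext p
          simp [Fin.lt_def, h0]
        simp [this] at h
      · exact h0
    let p : Fin k := ⟨i - 1, by omega⟩
    have hp : Finset.Iio i = Finset.Iic p := by
      ext q
      simp only [Finset.mem_Iio, Finset.mem_Iic, Fin.lt_def, Fin.le_def, p]
      omega
    rw [hp] at h
    have hsub : (Finset.univ.filter fun q : Fin k => ∑ j ∈ Finset.Iic q, m j ≤ a) ⊆
        Finset.Iio p := by
      intro q hq
      rw [Finset.mem_filter] at hq
      rw [Finset.mem_Iio]
      by_contra! hpq
      exact absurd (h.trans_le (hmono p q hpq)) (not_lt.2 hq.2)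
    have := Finset.card_le_card hsub
    rw [Fin.card_Iio] at this
    unfold blk
    simp only [p] at this
    omega

theorem blk_lt_of_lt_sum {k : ℕ} (m : Fin k → ℕ) {a : ℕ} (ha : a < ∑ i, m i) :
    blk k m a < k := by
  by_contra! h
  have huniv : (Finset.univ.filter fun i : Fin k => ∑ j ∈ Finset.Iic i, m j ≤ a) =
      Finset.univ := Finset.eq_univ_of_card _ (le_antisymm (Finset.card_le_univ _)
        ((Fintype.card_fin k).trans_le h))
  rcases Nat.eq_zero_or_pos k with rfl | hk
  · simp at ha
  · have hlast : (⟨k - 1, by omega⟩ : Fin k) ∈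
        Finset.univ.filter fun i : Fin k => ∑ j ∈ Finset.Iic i, m j ≤ a := by
      rw [huniv]; exact Finset.mem_univ _
    have hIic : Finset.Iic (⟨k - 1, by omega⟩ : Fin k) = Finset.univ := by
      ext q
      simp only [Finset.mem_Iic, Fin.le_def, Finset.mem_univ, iff_true]
      omega
    rw [Finset.mem_filter, hIic] at hlast
    omega

theorem card_filter_blk_lt {n k : ℕ} (m : Fin k → ℕ) (hsum : ∑ i, m i = n) (s : Fin k) :
    (Finset.univ.filter fun a : Fin n => blk k m a < s).card = ∑ j ∈ Finset.Iio s, m j := by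
  simp only [blk_lt_iff]
  have hle : ∑ j ∈ Finset.Iio s, m j ≤ n :=
    hsum ▸ Finset.sum_le_sum_of_subset (Finset.subset_univ _)
  rw [Fin.card_filter_val_lt, min_eq_right hle]

theorem Egen_commutator (n : ℕ) (i j m l : Fin n) :
    Egen n i j * Egen n m l - Egen n m l * Egen n i j =
      (X : Ct) • ((if j = m then Egen n i l else 0) - (if i = l then Egen n m j else 0)) := by
  have h := RingQuot.mkAlgHom_rel Ct (glRel.comm i j l m)
  simp only [map_sub, map_mul, map_smul, ite_smul, one_smul, zero_smul] at h
  simp only [Egen]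
  convert h using 3 <;> split_ifs <;> simp

theorem isAdjointMatrix_EmatOp (n : ℕ) : IsAdjointMatrix (X : Ct) (Egen n) (EmatOp n) :=
  fun a b i j => Egen_commutator n a b i j

theorem adjoin_range_Egen (n : ℕ) :
    Algebra.adjoin Ct (Set.range (Function.uncurry (Egen n))) = ⊤ := by
  have h : Set.range (Function.uncurry (Egen n)) =
      RingQuot.mkAlgHom Ct (glRel n) '' Set.range (FreeAlgebra.ι Ct) := by
    rw [← Set.range_comp]
    rfl
  rw [h, ← AlgHom.map_adjoin, FreeAlgebra.adjoin_range_ι, Algebra.map_top,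
    AlgHom.range_eq_top]
  exact RingQuot.mkAlgHom_surjective _ _

theorem iotaU_single (n : ℕ) (a c : Fin n) (r : Ct) :
    iotaU n (Matrix.single a c r) = r • Egen n a c := by
  rw [iotaU, Finset.sum_eq_single a, Finset.sum_eq_single c]
  · simp
  · intro j _ hj
    rw [Matrix.single_apply_of_col_ne _ _ hj.symm, zero_smul]
  · simp
  · intro i _ hi
    refine Finset.sum_eq_zero fun j _ => ?_
    rw [Matrix.single_apply_of_row_ne hi.symm, zero_smul]
  · simp

theorem pChar_single {n k : ℕ} (m : Fin k → ℕ) (lam : Fin k → ℂ) (a c : Fin n) (r : Ct) :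
    pChar n k m lam (Matrix.single a c r) =
      if a = c then C (lamExt k lam (blk k m a)) * r else 0 := by
  rw [pChar, Finset.sum_eq_single a]
  · simp [Matrix.single_apply, eq_comm]
  · intro i _ hi
    rw [Matrix.single_apply_of_row_ne hi.symm, mul_zero]
  · simp

theorem Egen_sub_mem_VermaIdeal {n k : ℕ} (m : Fin k → ℕ) (lam : Fin k → ℂ) (a c : Fin n)
    (h : blk k m a ≤ blk k m c) :
    Egen n a c - (if a = c then algebraMap Ct (Ugt n) (C (lamExt k lam (blk k m a))) else 0) ∈
      VermaIdeal n k m lam := by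
  refine Submodule.subset_span ⟨Matrix.single a c 1, ?_, ?_⟩
  · intro p q hpq
    refine Matrix.single_apply_of_ne _ _ _ _ _ ?_
    rintro ⟨rfl, rfl⟩
    omega
  · rw [iotaU_single, pChar_single, one_smul, mul_one]
    congr 1
    split_ifs
    · rfl
    · rw [map_zero]

theorem smul_quotient_eq_zero {R : Type*} [Ring R] (L : Submodule R R) {u : R}
    (h : ∀ w, u * w ∈ L) (v : R ⧸ L) : u • v = 0 := by
  obtain ⟨w, rfl⟩ := Submodule.Quotient.mk_surjective L v
  exact (Submodule.Quotient.mk_eq_zero L).2 (h w)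

theorem mem_annSet {n k : ℕ} (m : Fin k → ℕ) (lam : Fin k → ℂ) {u : Ugt n}
    (h : ∀ w : Ugt n, u * w ∈ VermaIdeal n k m lam) : u ∈ annSet n k m lam :=
  @smul_quotient_eq_zero (Ugt n) (RingQuot.instRing (glRel n)) (VermaIdeal n k m lam) u h

/-- for every `λ ∈ ℂ^k`, with `μ_i = λ_i − (m₁+⋯+m_{i−1})t`, every entry of the
matrix `(E−μ₁)⋯(E−μ_k)` annihilates the generalized Verma module `V_{p_t,λ}`. -/
theorem statement6 (n k : ℕ) (hn : 1 ≤ n) (hk : 1 ≤ k) (hkn : k ≤ n)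
    (m : Fin k → ℕ) (hm : ∀ i, 0 < m i) (hsum : ∑ i, m i = n)
    (lam : Fin k → ℂ)
    (μ : Fin k → Ct)
    (hμ : ∀ i, μ i = C (lam i) - (∑ j ∈ Finset.Iio i, (m j : Ct)) * X) :
    ∀ i j : Fin n, prodE n k μ i j ∈ annSet n k m lam := by
  have hμ' : ∀ s : Fin k, C (lamExt k lam s) - μ s =
      (Finset.univ.filter fun a : Fin n => blk k m a < s).card • (X : Ct) := by
    intro s
    rw [card_filter_blk_lt m hsum, hμ, lamExt, dif_pos s.2, sub_sub_cancel, nsmul_eq_mul,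
      Nat.cast_sum]
  have hmem := fun i j : Fin n => unop_prod_mem_of_block_lt (fun _ _ => rfl)
    (isAdjointMatrix_EmatOp n) (VermaIdeal n k m lam) (fun a => blk k m a)
    (fun s => C (lamExt k lam s)) (Egen_sub_mem_VermaIdeal m lam) μ hμ' i j
    (blk_lt_of_lt_sum m (hsum.symm ▸ i.2))
  intro i j
  refine mem_annSet m lam fun w => ?_
  refine ((isAdjointMatrix_EmatOp n).prod_sub_algebraMap μ).mul_mem (VermaIdeal n k m lam) hmem
    ?_ i j
  rw [adjoin_range_Egen]
  exact Algebra.mem_top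

end
end

section
/- Let t be a nonzero complex number, m = (m₁,…,m_k) positive integers summing to n, and μ = (μ₁,…,μ_k) ∈ ℂ^k with pairwise distinct coordinates. The ℂ-algebra A_{m,μ,t} admits a nonzero finite-dimensional representation (a ℂ-algebra homomorphism to the endomorphism algebra of a nonzero finite-dimensional complex vector space) if and only if there exists a permutation τ of {1,…,k} such that (μ_{τ(i)} − μ_{τ(i+1)})/t − m_{τ(i)} is a nonnegative integer for every i = 1,…,k−1. Moreover, when such a representation exists, A_{m,μ,t} has, up to isomorphism, exactly one irreducible finite-dimensional module. -/
noncomputable section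

open MulOpposite

abbrev FAc (n : ℕ) : Type := FreeAlgebra ℂ (Fin n × Fin n)

/-- The defining relations of `U_t`, the universal enveloping algebra of `gl(n,ℂ)` with the
Lie bracket rescaled by `t`. -/
inductive glRelC (n : ℕ) (t : ℂ) : FAc n → FAc n → Prop
  | comm (i j l m : Fin n) :
      glRelC n t
        (FreeAlgebra.ι ℂ ((i, j) : Fin n × Fin n) * FreeAlgebra.ι ℂ ((m, l) : Fin n × Fin n)
          - FreeAlgebra.ι ℂ ((m, l) : Fin n × Fin n) * FreeAlgebra.ι ℂ ((i, j) : Fin n × Fin n))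
        (t • ((if j = m then (1 : ℂ) else 0) • FreeAlgebra.ι ℂ ((i, l) : Fin n × Fin n)
          - (if i = l then (1 : ℂ) else 0) • FreeAlgebra.ι ℂ ((m, j) : Fin n × Fin n)))

/-- The algebra `U_t`. -/
abbrev Uc (n : ℕ) (t : ℂ) : Type := RingQuot (glRelC n t)

noncomputable instance instRingRingQuotUc (n : ℕ) (t : ℂ) (r : Uc n t → Uc n t → Prop) :
    Ring (RingQuot r) :=
  RingQuot.instRing r

/-- The generator `E^i_j` of `U_t`. -/
def EgenC (n : ℕ) (t : ℂ) (i j : Fin n) : Uc n t :=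
  RingQuot.mkAlgHom ℂ (glRelC n t) (FreeAlgebra.ι ℂ (i, j))

/-- The matrix `E`, with entries in the opposite algebra (used for the "paper" product
convention `(E^ℓ)^i_j = Σ E^{α₁}_j E^{α₂}_{α₁} ⋯ E^i_{α_{ℓ-1}}`). -/
def EmatOpC (n : ℕ) (t : ℂ) : Matrix (Fin n) (Fin n) (Uc n t)ᵐᵒᵖ :=
  Matrix.of fun i j => op (EgenC n t i j)

/-- Entries of `(E-μ₁)⋯(E-μ_k)` in the paper's convention. -/
def prodEC (n k : ℕ) (t : ℂ) (μ : Fin k → ℂ) : Matrix (Fin n) (Fin n) (Uc n t) :=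
  Matrix.of fun i j =>
    unop (((List.ofFn fun s : Fin k =>
      EmatOpC n t - algebraMap ℂ (Matrix (Fin n) (Fin n) (Uc n t)ᵐᵒᵖ) (μ s)).prod) i j)

/-- `Tr E^ℓ`. -/
def trEC (n : ℕ) (t : ℂ) (ℓ : ℕ) : Uc n t := unop (Matrix.trace (EmatOpC n t ^ ℓ))

/-- Generators of the ideal defining `A_{m,μ,t}`. -/
def genSetC (n k : ℕ) (t : ℂ) (m : Fin k → ℕ) (μ : Fin k → ℂ) : Set (Uc n t) :=
  {u | ∃ i j : Fin n, u = prodEC n k t μ i j} ∪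
  {u | ∃ ℓ ∈ Finset.Icc 1 (k - 1), u = trEC n t ℓ - algebraMap ℂ (Uc n t) (theta m μ t ℓ)}

/-- The `ℂ`-algebra `A_{m,μ,t}`. -/
abbrev AlgC (n k : ℕ) (t : ℂ) (m : Fin k → ℕ) (μ : Fin k → ℂ) : Type :=
  RingQuot (fun a b : Uc n t => a - b ∈ genSetC n k t m μ)

section GlRelations

variable {n : ℕ} {B : Type*} [Ring B] [Algebra ℂ B]

/-- The entries of `p(E)`, with products of matrices taken over the opposite algebra. -/
def polyEntry (E : Fin n → Fin n → B) (p : Polynomial ℂ) (i j : Fin n) : B :=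
  unop ((Polynomial.aeval (Matrix.of fun i j => op (E i j) : Matrix (Fin n) (Fin n) Bᵐᵒᵖ) p) i j)

/-- The commutation relations of `gl(n)`, rescaled by `t`. -/
def IsGlFamily (t : ℂ) (E : Fin n → Fin n → B) : Prop :=
  ∀ i j l m, E i j * E m l - E m l * E i j =
    t • ((if j = m then (1 : ℂ) else 0) • E i l - (if i = l then (1 : ℂ) else 0) • E m j)

theorem polyEntry_add (E : Fin n → Fin n → B) (p q : Polynomial ℂ) (i j : Fin n) :
    polyEntry E (p + q) i j = polyEntry E p i j + polyEntry E q i j := by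
  simp [polyEntry]

theorem polyEntry_sub (E : Fin n → Fin n → B) (p q : Polynomial ℂ) (i j : Fin n) :
    polyEntry E (p - q) i j = polyEntry E p i j - polyEntry E q i j := by
  simp [polyEntry]

theorem polyEntry_smul (E : Fin n → Fin n → B) (a : ℂ) (p : Polynomial ℂ) (i j : Fin n) :
    polyEntry E (a • p) i j = a • polyEntry E p i j := by
  simp [polyEntry]

theorem polyEntry_one (E : Fin n → Fin n → B) (i j : Fin n) :
    polyEntry E 1 i j = if i = j then 1 else 0 := by
  simp only [polyEntry, map_one, Matrix.one_apply]
  split_ifs <;> simp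

theorem polyEntry_X (E : Fin n → Fin n → B) (i j : Fin n) :
    polyEntry E Polynomial.X i j = E i j := by
  simp [polyEntry]

theorem polyEntry_C (E : Fin n → Fin n → B) (a : ℂ) (i j : Fin n) :
    polyEntry E (Polynomial.C a) i j = if i = j then algebraMap ℂ B a else 0 := by
  rw [show Polynomial.C a = a • (1 : Polynomial ℂ) by simp [Polynomial.smul_eq_C_mul],
    polyEntry_smul, polyEntry_one]
  split_ifs <;> simp [Algebra.algebraMap_eq_smul_one]

theorem polyEntry_mul (E : Fin n → Fin n → B) (p q : Polynomial ℂ) (i j : Fin n) :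
    polyEntry E (p * q) i j = ∑ α, polyEntry E q α j * polyEntry E p i α := by
  simp [polyEntry, Matrix.mul_apply, Finset.unop_sum]

theorem polyEntry_mul_X (E : Fin n → Fin n → B) (p : Polynomial ℂ) (i j : Fin n) :
    polyEntry E (p * Polynomial.X) i j = ∑ α, E α j * polyEntry E p i α := by
  simp [polyEntry_mul, polyEntry_X]

theorem polyEntry_mul_X' (E : Fin n → Fin n → B) (p : Polynomial ℂ) (i j : Fin n) :
    polyEntry E (p * Polynomial.X) i j = ∑ α, polyEntry E p α j * E i α := by
  rw [mul_comm]
  simp [polyEntry_mul, polyEntry_X]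

theorem IsGlFamily.comm_polyEntry {t : ℂ} {E : Fin n → Fin n → B} (hE : IsGlFamily t E)
    (p : Polynomial ℂ) : ∀ i j l m, E i j * polyEntry E p m l - polyEntry E p m l * E i j =
    t • ((if j = m then (1 : ℂ) else 0) • polyEntry E p i l
      - (if i = l then (1 : ℂ) else 0) • polyEntry E p m j) := by
  induction p using Polynomial.induction_on' with
  | add p q hp hq =>
    intro i j l m
    have h := congrArg₂ (· + ·) (hp i j l m) (hq i j l m)
    simp only [polyEntry_add, mul_add, add_mul, smul_add, smul_sub] at h ⊢
    rw [add_sub_add_comm, h]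
    abel
  | monomial k a =>
    rw [← mul_one a, ← smul_eq_mul, ← Polynomial.smul_monomial]
    have key : ∀ i j l m, E i j * polyEntry E (Polynomial.monomial k 1) m l
        - polyEntry E (Polynomial.monomial k 1) m l * E i j =
        t • ((if j = m then (1 : ℂ) else 0) • polyEntry E (Polynomial.monomial k 1) i l
        - (if i = l then (1 : ℂ) else 0) • polyEntry E (Polynomial.monomial k 1) m j) := by
      simp only [← Polynomial.X_pow_eq_monomial]
      induction k with
      | zero =>
        intro i j l m
        simp only [pow_zero, polyEntry_one]
        by_cases h1 : j = m <;> by_cases h2 : i = l <;> by_cases h3 : m = l <;>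
          by_cases h4 : i = j <;> subst_vars <;> simp_all [eq_comm]
      | succ k ih =>
        intro i j l m
        set P := polyEntry E (Polynomial.X ^ k) with hP
        simp only [pow_succ, polyEntry_mul_X, ← hP]
        have h1 : ∀ α, E i j * (E α l * P m α) - E α l * P m α * E i j =
            (E i j * E α l - E α l * E i j) * P m α
              + E α l * (E i j * P m α - P m α * E i j) := by
          intro α; noncomm_ring
        rw [Finset.mul_sum, Finset.sum_mul, ← Finset.sum_sub_distrib]
        simp only [h1, ih, hE i j l]
        simp only [mul_smul_comm, smul_mul_assoc, sub_mul, mul_sub, smul_sub,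
          Finset.sum_add_distrib, Finset.sum_sub_distrib, ← Finset.smul_sum]
        simp only [ite_smul, one_smul, zero_smul, Finset.sum_ite_eq, Finset.mem_univ, if_true]
        abel
    intro i j l m
    simp only [polyEntry_smul, mul_smul_comm, smul_mul_assoc, ← smul_sub, key]
    simp only [smul_sub, smul_smul]
    congr 2 <;> ring

end GlRelations

section HighestWeight

variable {n : ℕ} {B : Type*} [Ring B] [Algebra ℂ B]
  {V : Type*} [AddCommGroup V] [Module ℂ V]

/-- `v` is killed by the raising operators and is a simultaneous eigenvector, with eigenvalues
`w i`, of the diagonal ones. -/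
structure IsHighestWeight (E : Fin n → Fin n → B) (ρ : B →ₐ[ℂ] Module.End ℂ V) (w : Fin n → ℂ)
    (v : V) : Prop where
  raise : ∀ i j, i < j → ρ (E i j) v = 0
  diag : ∀ i, ρ (E i i) v = w i • v

/-- The eigenvalues of the diagonal entries of the powers of `E` on a highest weight vector. -/
def diagEigen (t : ℂ) (l : Fin n → ℂ) : ℕ → Fin n → ℂ
  | 0, _ => 1
  | r + 1, i => l i * diagEigen t l r i + t * ∑ α, if α < i then diagEigen t l r α else 0

variable {E : Fin n → Fin n → B} {ρ : B →ₐ[ℂ] Module.End ℂ V} {w : Fin n → ℂ} {v : V} {t : ℂ}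

theorem IsGlFamily.polyEntry_apply (hE : IsGlFamily t E) (ρ : B →ₐ[ℂ] Module.End ℂ V)
    (p : Polynomial ℂ) (i j m l : Fin n) (x : V) :
    ρ (polyEntry E p m l) (ρ (E i j) x) = ρ (E i j) (ρ (polyEntry E p m l) x)
      - t • ((if j = m then (1 : ℂ) else 0) • ρ (polyEntry E p i l) x
        - (if i = l then (1 : ℂ) else 0) • ρ (polyEntry E p m j) x) := by
  have h := congrArg (fun b => ρ b x) (hE.comm_polyEntry p i j l m)
  simp only [map_sub, map_mul, map_smul, LinearMap.sub_apply, Module.End.mul_apply,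
    LinearMap.smul_apply] at h
  rw [← h]
  abel

theorem polyEntry_mul_X_apply (p : Polynomial ℂ) (i j : Fin n) (x : V) :
    ρ (polyEntry E (p * Polynomial.X) i j) x = ∑ α, ρ (polyEntry E p α j) (ρ (E i α) x) := by
  simp [polyEntry_mul_X', map_sum, LinearMap.sum_apply]

theorem IsHighestWeight.polyEntry_raise (hv : IsHighestWeight E ρ w v) (hE : IsGlFamily t E)
    (r : ℕ) : ∀ i j, i < j → ρ (polyEntry E (Polynomial.X ^ r) i j) v = 0 := by
  induction r with
  | zero =>
    intro i j hij
    simp [polyEntry_one, hij.ne]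
  | succ r ih =>
    intro i j hij
    rw [pow_succ, polyEntry_mul_X_apply]
    refine Finset.sum_eq_zero fun α _ => ?_
    rcases lt_trichotomy α i with h | rfl | h
    · rw [hE.polyEntry_apply, ih _ _ (h.trans hij), ih _ _ hij]
      simp [hij.ne]
    · rw [hv.diag, map_smul, ih _ _ hij, smul_zero]
    · rw [hv.raise _ _ h, map_zero]

theorem IsHighestWeight.polyEntry_diag (hv : IsHighestWeight E ρ w v) (hE : IsGlFamily t E)
    (r : ℕ) : ∀ i, ρ (polyEntry E (Polynomial.X ^ r) i i) v =
      diagEigen t (fun i => w i - t * (i : ℕ)) r i • v := by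
  induction r with
  | zero => intro i; simp [polyEntry_one, diagEigen]
  | succ r ih =>
    intro i
    set d := diagEigen t (fun i => w i - t * ((i : ℕ) : ℂ)) r with hd
    have h1 : ∀ α, ρ (polyEntry E (Polynomial.X ^ r) α i) (ρ (E i α) v) =
        (if α = i then (w i * d i) else 0) • v
          + (if α < i then t * (d α - d i) else 0) • v := by
      intro α
      rcases lt_trichotomy α i with h | rfl | h
      · rw [hE.polyEntry_apply, hv.polyEntry_raise hE r _ _ h, ih, ih]
        simp only [h, h.ne, if_true, if_false, map_zero, one_smul, zero_smul]
        module
      · rw [hv.diag, map_smul, ih, smul_smul]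
        simp
      · rw [hv.raise _ _ h, map_zero]
        simp [h.not_gt, h.ne']
    rw [pow_succ, polyEntry_mul_X_apply]
    simp only [h1]
    rw [Finset.sum_add_distrib, ← Finset.sum_smul, ← Finset.sum_smul, ← add_smul]
    congr 1
    have h2 : ∀ α : Fin n, (if α < i then t * (d α - d i) else 0) =
        t * (if α < i then d α else 0) - (if α < i then t * d i else 0) := by
      intro α; split_ifs <;> ring
    have h3 : ∑ α : Fin n, (if α < i then t * d i else 0) = (i : ℕ) * (t * d i) := by
      rw [← Finset.sum_filter, Finset.sum_const, nsmul_eq_mul]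
      rw [Finset.filter_gt_eq_Iio, Fin.card_Iio]
    simp only [h2, Finset.sum_sub_distrib, h3, ← Finset.mul_sum]
    simp only [diagEigen, ← hd, Finset.sum_ite_eq', Finset.mem_univ, if_true]
    ring

end HighestWeight

section GeneratingFunction

open PowerSeries

/-- `1 - a X`. -/
abbrev linFactor (a : ℂ) : PowerSeries ℂ := 1 - C a * X

theorem prod_linFactor_mul_eq {t : ℂ} : ∀ {n : ℕ} (l : Fin n → ℂ) (g : Fin n → PowerSeries ℂ),
    (∀ i, g i * linFactor (l i) = 1 + C t * X * ∑ α, if α < i then g α else 0) →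
    (1 + C t * X * ∑ i, g i) * ∏ i, linFactor (l i) = ∏ i, linFactor (l i - t) := by
  intro n
  induction n with
  | zero => intro l g _; simp
  | succ n ih =>
    intro l g h
    have h1 := ih (fun i => l i.castSucc) (fun i => g i.castSucc) fun i => by
      rw [h]
      simp [Fin.sum_univ_castSucc, (Fin.castSucc_lt_last i).not_gt]
    have h2 := h (Fin.last n)
    simp only [Fin.sum_univ_castSucc, Fin.castSucc_lt_last, if_true, lt_irrefl, if_false,
      add_zero] at h2
    rw [Fin.prod_univ_castSucc, Fin.prod_univ_castSucc, Fin.sum_univ_castSucc, ← h1]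
    have h3 : linFactor (l (Fin.last n) - t) = linFactor (l (Fin.last n)) + C t * X := by
      simp [linFactor]; ring
    rw [h3]
    linear_combination (C t * X * ∏ i : Fin n, linFactor (l i.castSucc)) * h2

theorem traceSeries_mul_prod {n : ℕ} (t : ℂ) (l : Fin n → ℂ) :
    (1 + C t * X * mk fun r => ∑ i, diagEigen t l r i) * ∏ i, linFactor (l i) =
      ∏ i, linFactor (l i - t) := by
  have h := prod_linFactor_mul_eq (t := t) l (fun i => mk fun r => diagEigen t l r i) ?_
  · rw [← h]
    congr 3
    ext r
    simp
  · intro i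
    have e1 : (mk (fun r => diagEigen t l r i) : PowerSeries ℂ) * linFactor (l i) =
      mk (fun r => diagEigen t l r i) - C (l i) * ((mk fun r => diagEigen t l r i) * X) := by
      simp only [linFactor]; ring
    have e2 : 1 + C t * X * ∑ α, (if α < i then mk (fun r => diagEigen t l r α) else 0) =
      1 + C t * ((∑ α, if α < i then (mk (fun r => diagEigen t l r α) : PowerSeries ℂ) else 0)
        * X) := by ring
    rw [e1, e2]
    ext r
    rcases r with _ | r
    · simp [diagEigen]
    · simp only [map_sub, map_add, coeff_C_mul, coeff_succ_mul_X, coeff_mk, map_sum, coeff_one,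
        diagEigen, apply_ite (coeff r), map_zero]
      simp

theorem thetaSeries_mul_prod {k : ℕ} (f : ℕ → ℂ) (m : Fin k → ℕ) (μ : Fin k → ℂ) (t : ℂ)
    (hf : ∀ r, t * f r = ∑ J ∈ (Finset.univ : Finset (Fin k)).powerset.filter
      (fun J => J.Nonempty ∧ J.card ≤ r + 1),
      (∏ j ∈ J, (t * (m j : ℂ))) *
        ∑ d ∈ J.finsuppAntidiag (r + 1 - J.card), ∏ j ∈ J, μ j ^ d j) :
    (1 + C t * X * mk f) * ∏ s, linFactor (μ s) = ∏ s, linFactor (μ s - t * m s) := by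
  have geo : ∀ a : ℂ, (mk fun r => a ^ r) * linFactor a = 1 := by
    intro a
    have e1 : (mk (fun r => a ^ r) : PowerSeries ℂ) * linFactor a =
      mk (fun r => a ^ r) - C a * ((mk fun r => a ^ r) * X) := by
      simp only [linFactor]; ring
    rw [e1]
    ext r
    rcases r with _ | r
    · simp
    · simp [coeff_succ_mul_X, coeff_C_mul, coeff_one, pow_succ']
  have h1 : ∏ s, linFactor (μ s - t * m s) =
      (∏ s, (1 + C (t * m s) * X * mk fun r => μ s ^ r)) * ∏ s, linFactor (μ s) := by
    rw [← Finset.prod_mul_distrib]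
    refine Finset.prod_congr rfl fun s _ => ?_
    have : linFactor (μ s - t * m s) = linFactor (μ s) + C (t * m s) * X := by
      simp [linFactor]; ring
    rw [this]
    linear_combination (- (C (t * m s) * X : PowerSeries ℂ)) * geo (μ s)
  rw [h1]
  congr 1
  rw [Finset.prod_one_add]
  have h2 : ∀ J : Finset (Fin k), ∏ s ∈ J, (C (t * m s) * X * mk fun r => μ s ^ r) =
      C (∏ s ∈ J, (t * m s)) * ((∏ s ∈ J, mk fun r => μ s ^ r) * X ^ J.card) := by
    intro J
    rw [Finset.prod_mul_distrib, Finset.prod_mul_distrib, Finset.prod_const, map_prod]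
    ring
  simp only [h2]
  have e0 : (1 + C t * X * mk f : PowerSeries ℂ) = 1 + C t * (mk f * X) := by ring
  rw [e0]
  ext r
  rcases r with _ | r
  · rw [map_sum, Finset.sum_eq_single ∅]
    · simp
    · intro J _ hJ
      have : J.card ≠ 0 := by simpa using hJ
      simp [this]
    · simp
  · rw [map_sum]
    simp only [map_add, coeff_C_mul, coeff_succ_mul_X, coeff_mk, coeff_one, hf,
      Finset.sum_filter, coeff_mul_X_pow', coeff_prod]
    simp only [Nat.add_eq_zero_iff, one_ne_zero, and_false, if_false, zero_add]
    refine Finset.sum_congr rfl fun J _ => ?_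
    rcases J.eq_empty_or_nonempty with rfl | hJ
    · simp
    · by_cases h : J.card ≤ r + 1 <;> simp [h, hJ]

theorem mul_theta {k : ℕ} (m : Fin k → ℕ) (μ : Fin k → ℂ) (t : ℂ) (r : ℕ) :
    t * theta m μ t r = ∑ J ∈ (Finset.univ : Finset (Fin k)).powerset.filter
      (fun J => J.Nonempty ∧ J.card ≤ r + 1),
      (∏ j ∈ J, (t * (m j : ℂ))) *
        ∑ d ∈ J.finsuppAntidiag (r + 1 - J.card), ∏ j ∈ J, μ j ^ d j := by
  rw [← Finset.sum_fiberwise_of_maps_to (t := Finset.Icc 1 k) (g := Finset.card)]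
  · rw [theta, Finset.mul_sum]
    refine Finset.sum_congr rfl fun s hs => ?_
    have hs1 : 1 ≤ s := (Finset.mem_Icc.mp hs).1
    rw [Finset.filter_filter]
    split_ifs with h
    · rw [← mul_assoc, ← pow_succ', Nat.sub_add_cancel hs1, Finset.mul_sum]
      refine Finset.sum_congr ?_ fun J hJ => ?_
      · ext J
        simp only [Finset.mem_powersetCard, Finset.mem_filter, Finset.mem_powerset]
        constructor
        · rintro ⟨h1, rfl⟩
          exact ⟨h1, ⟨Finset.card_pos.mp hs1, h⟩, rfl⟩
        · rintro ⟨h1, _, h2⟩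
          exact ⟨h1, h2⟩
      · simp only [Finset.mem_filter] at hJ
        obtain ⟨-, -, rfl⟩ := hJ
        rw [Finset.prod_mul_distrib, Finset.prod_const, mul_assoc]
    · rw [mul_zero]
      symm
      refine Finset.sum_eq_zero fun J hJ => ?_
      simp only [Finset.mem_filter] at hJ
      omega
  · intro J hJ
    simp only [Finset.mem_filter] at hJ
    rw [Finset.mem_Icc]
    exact ⟨Finset.card_pos.mpr hJ.2.1, by simpa using Finset.card_le_univ J⟩

theorem thetaSeries_eq {k : ℕ} (m : Fin k → ℕ) (μ : Fin k → ℂ) (t : ℂ) :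
    (1 + C t * X * mk (theta m μ t)) * ∏ s, linFactor (μ s) = ∏ s, linFactor (μ s - t * m s) :=
  thetaSeries_mul_prod _ m μ t (mul_theta m μ t)

theorem theta_zero {k : ℕ} (m : Fin k → ℕ) (μ : Fin k → ℂ) (t : ℂ) (ht : t ≠ 0) :
    theta m μ t 0 = ∑ s, (m s : ℂ) := by
  refine mul_left_cancel₀ ht ?_
  have h : (Finset.univ : Finset (Fin k)).powerset.filter (fun J => J.Nonempty ∧ J.card ≤ 0 + 1) =
      (Finset.univ : Finset (Fin k)).map ⟨fun j => {j}, Finset.singleton_injective⟩ := by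
    ext J
    simp only [Finset.mem_filter, Finset.mem_powerset, Finset.subset_univ, true_and,
      Finset.mem_map, Finset.mem_univ, Function.Embedding.coeFn_mk, zero_add]
    constructor
    · rintro ⟨h1, h2⟩
      obtain ⟨a, rfl⟩ := Finset.card_eq_one.mp (le_antisymm h2 (Finset.card_pos.mpr h1))
      exact ⟨a, rfl⟩
    · rintro ⟨a, rfl⟩
      simp
  rw [mul_theta, h, Finset.sum_map, Finset.mul_sum]
  simp

end GeneratingFunction

section Spectrum

open PowerSeries

theorem coeff_prod_linFactor_mul {ι : Type*} (μ : ι → ℂ) (τ : Polynomial ℂ →ₗ[ℂ] ℂ)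
    (J : Finset ι) : ∀ r, coeff (J.card + r)
      ((∏ s ∈ J, linFactor (μ s)) * mk fun r => τ (Polynomial.X ^ r)) =
      τ (Polynomial.X ^ r * ∏ s ∈ J, (Polynomial.X - Polynomial.C (μ s))) := by
  classical
  induction J using Finset.induction_on with
  | empty => intro r; simp
  | insert a J ha ih =>
    intro r
    rw [Finset.prod_insert ha, Finset.prod_insert ha, Finset.card_insert_of_notMem ha]
    have e1 : (linFactor (μ a) * ∏ s ∈ J, linFactor (μ s)) * mk (fun r => τ (Polynomial.X ^ r)) =
        ((∏ s ∈ J, linFactor (μ s)) * mk fun r => τ (Polynomial.X ^ r)) -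
        C (μ a) * (((∏ s ∈ J, linFactor (μ s)) * mk fun r => τ (Polynomial.X ^ r)) * X) := by
      simp only [linFactor]; ring
    have e2 : (Polynomial.X ^ r * ((Polynomial.X - Polynomial.C (μ a)) *
        ∏ s ∈ J, (Polynomial.X - Polynomial.C (μ s))) : Polynomial ℂ) =
        Polynomial.X ^ (r + 1) * ∏ s ∈ J, (Polynomial.X - Polynomial.C (μ s)) -
        μ a • (Polynomial.X ^ r * ∏ s ∈ J, (Polynomial.X - Polynomial.C (μ s))) := by
      rw [Polynomial.smul_eq_C_mul]; ring
    rw [e1, e2, map_sub, map_sub, map_smul, ← ih, ← ih, coeff_C_mul, smul_eq_mul,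
      show J.card + 1 + r = (J.card + r) + 1 by ring, coeff_succ_mul_X]
    rfl

theorem coeff_prod_linFactor_of_card_lt {ι : Type*} (μ : ι → ℂ) (J : Finset ι) :
    ∀ r, J.card < r → coeff r (∏ s ∈ J, linFactor (μ s)) = 0 := by
  classical
  induction J using Finset.induction_on with
  | empty => intro r hr; simp at hr; simp [coeff_one, hr.ne']
  | insert a J ha ih =>
    intro r hr
    rw [Finset.card_insert_of_notMem ha] at hr
    obtain ⟨r, rfl⟩ : ∃ r', r = r' + 1 := ⟨r - 1, by omega⟩
    rw [Finset.prod_insert ha, show linFactor (μ a) * ∏ s ∈ J, linFactor (μ s) =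
      (∏ s ∈ J, linFactor (μ s)) - C (μ a) * ((∏ s ∈ J, linFactor (μ s)) * X) by
        simp only [linFactor]; ring, map_sub, coeff_C_mul, coeff_succ_mul_X,
        ih _ (by omega), ih _ (by omega)]
    simp

/-- The first `k` terms of the sequences determine the rest, since both are annihilated by the
recurrence with characteristic polynomial `∏ (X - μ s)`. -/
theorem traceSeries_mul_prod_of_recurrence {k : ℕ} (t : ℂ) (μ ν : Fin k → ℂ)
    (τ : Polynomial ℂ →ₗ[ℂ] ℂ) (f : ℕ → ℂ)
    (hτ : ∀ r, τ (Polynomial.X ^ r * ∏ s, (Polynomial.X - Polynomial.C (μ s))) = 0)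
    (hf : (1 + C t * X * mk f) * ∏ s, linFactor (μ s) = ∏ s, linFactor (ν s))
    (h : ∀ r, r < k → τ (Polynomial.X ^ r) = f r) :
    (1 + C t * X * mk fun r => τ (Polynomial.X ^ r)) * ∏ s, linFactor (μ s) =
      ∏ s, linFactor (ν s) := by
  ext r
  rcases le_or_gt r k with hr | hr
  · rw [← hf]
    have e : ∀ g : ℕ → ℂ, (1 + C t * X * mk g) * ∏ s, linFactor (μ s) =
        (∏ s, linFactor (μ s)) + C t * ((mk g * ∏ s, linFactor (μ s)) * X) := by
      intro g; ring
    rw [e, e, map_add, map_add, coeff_C_mul, coeff_C_mul]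
    congr 2
    rcases r with _ | r
    · simp
    · rw [coeff_succ_mul_X, coeff_succ_mul_X, coeff_mul, coeff_mul]
      refine Finset.sum_congr rfl fun p hp => ?_
      rw [coeff_mk, coeff_mk, h]
      have := Finset.HasAntidiagonal.mem_antidiagonal.mp hp
      omega
  · obtain ⟨r, rfl⟩ : ∃ r', r = k + r' + 1 := ⟨r - k - 1, by omega⟩
    rw [coeff_prod_linFactor_of_card_lt ν _ _ (by simp)]
    rw [show (1 + C t * X * mk fun r => τ (Polynomial.X ^ r)) * ∏ s, linFactor (μ s) =
      (∏ s, linFactor (μ s)) + C t *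
        (((∏ s, linFactor (μ s)) * mk fun r => τ (Polynomial.X ^ r)) * X) by ring,
      map_add, coeff_C_mul, coeff_succ_mul_X,
      coeff_prod_linFactor_of_card_lt μ _ _ (by simp)]
    have h1 := coeff_prod_linFactor_mul μ τ Finset.univ r
    rw [Finset.card_univ, Fintype.card_fin] at h1
    rw [h1, hτ]
    simp

theorem coe_reflect_prod (A : Multiset ℂ) :
    ((Polynomial.reflect A.card (A.map fun a => Polynomial.X - Polynomial.C a).prod :
      Polynomial ℂ) : PowerSeries ℂ) = (A.map linFactor).prod := by
  induction A using Multiset.induction_on with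
  | empty => simp [Polynomial.reflect_one]
  | cons a A ih =>
    rw [Multiset.map_cons, Multiset.prod_cons, Multiset.card_cons, Multiset.map_cons,
      Multiset.prod_cons, add_comm, Polynomial.reflect_mul, Polynomial.coe_mul, ih]
    · congr 1
      rw [Polynomial.reflect_sub, Polynomial.reflect_C, Polynomial.reflect_one_X]
      simp [linFactor]
    · simp
    · rw [Polynomial.natDegree_multiset_prod_X_sub_C_eq_card]

theorem multiset_eq_of_prod_linFactor {A A' : Multiset ℂ} (hc : A.card = A'.card)
    (h : (A.map linFactor).prod = (A'.map linFactor).prod) : A = A' := by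
  rw [← coe_reflect_prod, ← coe_reflect_prod, Polynomial.coe_inj, hc] at h
  have h2 := congrArg (Polynomial.reflect A'.card) h
  rw [Polynomial.reflect_reflect, Polynomial.reflect_reflect] at h2
  rw [← Polynomial.roots_multiset_prod_X_sub_C A, h2, Polynomial.roots_multiset_prod_X_sub_C]

/-- The union of the strings `μ s, μ s - t, …, μ s - (m s - 1) t`. -/
def stringUnion {k : ℕ} (t : ℂ) (m : Fin k → ℕ) (μ : Fin k → ℂ) : Multiset ℂ :=
  ∑ s, (Multiset.range (m s)).map fun j : ℕ => μ s - t * j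

theorem string_telescope (t a : ℂ) (r : ℕ) :
    {a} + ((Multiset.range r).map fun j : ℕ => a - t * j).map (· - t) =
      {a - t * r} + (Multiset.range r).map fun j : ℕ => a - t * j := by
  induction r with
  | zero => simp
  | succ r ih =>
    rw [Multiset.range_succ, Multiset.map_cons, Multiset.map_cons, ← Multiset.singleton_add,
      ← Multiset.singleton_add]
    rw [show ({a} : Multiset ℂ) + ({a - t * (r : ℂ) - t} +
      Multiset.map (· - t) (Multiset.map (fun j : ℕ => a - t * (j : ℂ)) (Multiset.range r))) =
      {a - t * (r : ℂ) - t} + ({a} +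
      Multiset.map (· - t) (Multiset.map (fun j : ℕ => a - t * (j : ℂ)) (Multiset.range r))) by
        abel, ih]
    congr 2
    push_cast
    ring

theorem stringUnion_telescope {k : ℕ} (t : ℂ) (m : Fin k → ℕ) (μ : Fin k → ℂ) :
    Finset.univ.val.map μ + (stringUnion t m μ).map (· - t) =
      (Finset.univ.val.map fun s => μ s - t * m s) + stringUnion t m μ := by
  have h1 : ∀ f : Fin k → ℂ, Finset.univ.val.map f = ∑ s, {f s} := by
    intro f
    rw [← Multiset.sum_map_singleton (Finset.univ.val.map f), Multiset.map_map]
    rfl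
  have h2 : (stringUnion t m μ).map (· - t) =
      ∑ s, ((Multiset.range (m s)).map fun j : ℕ => μ s - t * j).map (· - t) := by
    rw [stringUnion]
    exact map_sum (Multiset.mapAddMonoidHom (· - t)) _ _
  rw [h1, h1, h2, stringUnion, ← Finset.sum_add_distrib, ← Finset.sum_add_distrib]
  exact Finset.sum_congr rfl fun s _ => string_telescope t (μ s) (m s)

theorem eq_of_add_shift_eq {t : ℂ} (ht : t ≠ 0) {A A' : Multiset ℂ}
    (h : A + A'.map (· - t) = A' + A.map (· - t)) : A = A' := by
  classical
  have hinj : Function.Injective (fun x : ℂ => x - t) := sub_left_injective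
  have hcount : ∀ (D : Multiset ℂ) a, (D.map (· - t)).count a = D.count (a + t) := by
    intro D a
    have := Multiset.count_map_eq_count' (fun x : ℂ => x - t) D hinj (a + t)
    simpa using this
  have h1 : ∀ a, A.count a + A'.count (a + t) = A'.count a + A.count (a + t) := by
    intro a
    have := congrArg (Multiset.count a) h
    simpa [hcount] using this
  have h2 : ∀ a (N : ℕ), A.count a + A'.count (a + N * t) = A'.count a + A.count (a + N * t) := by
    intro a N
    induction N with
    | zero => simp [add_comm]
    | succ N ih =>
      have := h1 (a + N * t)
      rw [show a + ((N + 1 : ℕ) : ℂ) * t = a + N * t + t by push_cast; ring]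
      omega
  ext a
  have hfin : ((A + A').toFinset : Set ℂ).Finite := Finset.finite_toSet _
  have hinf : Function.Injective (fun N : ℕ => a + N * t) := by
    intro x y hxy
    simpa [ht] using hxy
  obtain ⟨N, hN⟩ : ∃ N : ℕ, a + N * t ∉ (A + A').toFinset := by
    by_contra! hcon
    exact Set.infinite_of_injective_forall_mem hinf (fun N => Finset.mem_coe.mpr (hcon N)) hfin
  simp only [Multiset.mem_toFinset, Multiset.mem_add, not_or] at hN
  have := h2 a N
  rw [Multiset.count_eq_zero_of_notMem hN.1, Multiset.count_eq_zero_of_notMem hN.2] at this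
  simpa using this

theorem map_eq_stringUnion {n k : ℕ} {t : ℂ} (ht : t ≠ 0) (l : Fin n → ℂ) (m : Fin k → ℕ)
    (μ : Fin k → ℂ) (G : PowerSeries ℂ)
    (h1 : G * ∏ i, linFactor (l i) = ∏ i, linFactor (l i - t))
    (h2 : G * ∏ s, linFactor (μ s) = ∏ s, linFactor (μ s - t * m s)) :
    Finset.univ.val.map l = stringUnion t m μ := by
  set L := Finset.univ.val.map l with hL
  have h3 : (∏ s, linFactor (μ s - t * m s)) * ∏ i, linFactor (l i) =
      (∏ s, linFactor (μ s)) * ∏ i, linFactor (l i - t) := by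
    rw [← h1, ← h2]; ring
  have h4 : (Finset.univ.val.map fun s => μ s - t * m s) + L =
      Finset.univ.val.map μ + L.map (· - t) := by
    refine multiset_eq_of_prod_linFactor (by simp [hL]) ?_
    simpa [hL, Finset.prod_eq_multiset_prod, Multiset.map_map, Function.comp_def] using h3
  refine eq_of_add_shift_eq ht ?_
  have h5 := stringUnion_telescope t m μ
  refine add_left_cancel (a := Finset.univ.val.map μ +
    (Finset.univ.val.map fun s => μ s - t * m s)) ?_
  calc _ = ((Finset.univ.val.map fun s => μ s - t * m s) + L) +
        (Finset.univ.val.map μ + (stringUnion t m μ).map (· - t)) := by abel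
    _ = _ := by rw [h4, h5]; abel

end Spectrum

section Existence

variable {n : ℕ} {B : Type*} [Ring B] [Algebra ℂ B]
  {V : Type*} [AddCommGroup V] [Module ℂ V]

/-- The element `-t⁻¹ ∑ i E^i_i`, whose adjoint action multiplies `E^a_b` by `b - a`. -/
def gradingElt (t : ℂ) (E : Fin n → Fin n → B) : B := ∑ i : Fin n, (-((i : ℕ) : ℂ) / t) • E i i

variable {E : Fin n → Fin n → B} {ρ : B →ₐ[ℂ] Module.End ℂ V} {w : Fin n → ℂ} {v : V} {t : ℂ}

theorem IsGlFamily.gradingElt_comm (hE : IsGlFamily t E) (ht : t ≠ 0) (a b : Fin n) :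
    gradingElt t E * E a b - E a b * gradingElt t E = (((b : ℕ) : ℂ) - (a : ℕ)) • E a b := by
  rw [gradingElt, Finset.sum_mul, Finset.mul_sum, ← Finset.sum_sub_distrib]
  simp only [smul_mul_assoc, mul_smul_comm, ← smul_sub, hE _ _ b a]
  simp only [ite_smul, one_smul, zero_smul, smul_sub, smul_ite, smul_zero, smul_smul,
    Finset.sum_sub_distrib, Finset.sum_ite_eq', Finset.mem_univ, if_true]
  rw [← sub_smul]
  congr 1
  field_simp
  ring

theorem IsGlFamily.gradingElt_apply (hE : IsGlFamily t E) (ht : t ≠ 0)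
    (ρ : B →ₐ[ℂ] Module.End ℂ V) (a b : Fin n) (h : ℂ) (x : V)
    (hx : ρ (gradingElt t E) x = h • x) :
    ρ (gradingElt t E) (ρ (E a b) x) = (h + (((b : ℕ) : ℂ) - (a : ℕ))) • ρ (E a b) x := by
  have h1 := congrArg (fun y => ρ y x) (hE.gradingElt_comm ht a b)
  simp only [map_sub, map_mul, map_smul, LinearMap.sub_apply, Module.End.mul_apply,
    LinearMap.smul_apply, hx] at h1
  rw [add_smul, ← h1]
  abel

theorem exists_joint_eigenvector {ι : Type*} [Finite ι] [FiniteDimensional ℂ V]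
    (T : ι → Module.End ℂ V) (hT : ∀ i j x, T i (T j x) = T j (T i x)) (W : Submodule ℂ V)
    (hW : W ≠ ⊥) (hTW : ∀ i, ∀ x ∈ W, T i x ∈ W) :
    ∃ v ∈ W, v ≠ 0 ∧ ∃ c : ι → ℂ, ∀ i, T i v = c i • v := by
  classical
  have := Fintype.ofFinite ι
  have key : ∀ J : Finset ι, ∃ W' ≤ W, W' ≠ ⊥ ∧ (∀ i, ∀ x ∈ W', T i x ∈ W') ∧
      ∃ c : ι → ℂ, ∀ i ∈ J, ∀ x ∈ W', T i x = c i • x := by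
    intro J
    induction J using Finset.induction_on with
    | empty => exact ⟨W, le_rfl, hW, hTW, 0, by simp⟩
    | insert a J ha ih =>
      obtain ⟨W', hle, hne, hst, c, hc⟩ := ih
      have : Nontrivial W' := Submodule.nontrivial_iff_ne_bot.mpr hne
      obtain ⟨e, he⟩ := Module.End.exists_eigenvalue ((T a).restrict (hst a))
      obtain ⟨x, hx⟩ := he.exists_hasEigenvector
      have hx1 : T a x = e • (x : V) := congrArg Subtype.val hx.apply_eq_smul
      refine ⟨W' ⊓ Module.End.eigenspace (T a) e, inf_le_left.trans hle, ?_, ?_,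
        Function.update c a e, ?_⟩
      · intro hbot
        have : (x : V) ∈ W' ⊓ Module.End.eigenspace (T a) e :=
          ⟨x.2, Module.End.mem_eigenspace_iff.mpr hx1⟩
        rw [hbot, Submodule.mem_bot] at this
        exact hx.2 (Subtype.ext this)
      · rintro i y ⟨hy1, hy2⟩
        refine ⟨hst i y hy1, Module.End.mem_eigenspace_iff.mpr ?_⟩
        rw [hT, Module.End.mem_eigenspace_iff.mp hy2, map_smul]
      · rintro i hi y ⟨hy1, hy2⟩
        rcases Finset.mem_insert.mp hi with rfl | hi
        · rw [Function.update_self, Module.End.mem_eigenspace_iff.mp hy2]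
        · rw [Function.update_of_ne (ne_of_mem_of_not_mem hi ha), hc i hi y hy1]
  obtain ⟨W', hle, hne, -, c, hc⟩ := key Finset.univ
  obtain ⟨x, hx, hx0⟩ := W'.ne_bot_iff.mp hne
  exact ⟨x, hle hx, hx0, c, fun i => hc i (Finset.mem_univ i) x hx⟩

theorem exists_isHighestWeight [FiniteDimensional ℂ V] [Nontrivial V] (hE : IsGlFamily t E)
    (ht : t ≠ 0) (ρ : B →ₐ[ℂ] Module.End ℂ V) :
    ∃ v : V, v ≠ 0 ∧ ∃ w : Fin n → ℂ, IsHighestWeight E ρ w v := by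
  set H := ρ (gradingElt t E) with hH
  obtain ⟨e, he⟩ := Module.End.exists_eigenvalue H
  have hfin : {N : ℕ | H.HasEigenvalue (e + N)}.Finite := by
    refine Set.Finite.preimage (f := fun N : ℕ => e + (N : ℂ)) ?_ H.finite_hasEigenvalue
    intro x _ y _ hxy
    simpa using hxy
  obtain ⟨N, hN, hmax⟩ := hfin.exists_maximal ⟨0, by simpa using he⟩
  have hcomm : ∀ i j x, ρ (E i i) (ρ (E j j) x) = ρ (E j j) (ρ (E i i) x) := by
    intro i j x
    have h1 := congrArg (fun y => ρ y x) (hE i i j j)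
    rw [← sub_eq_zero]
    have h2 : (t • ((if i = j then (1 : ℂ) else 0) • E i j - (if i = j then (1 : ℂ) else 0) • E j i))
        = 0 := by split_ifs with h <;> simp [h]
    rw [h2] at h1
    simpa using h1
  obtain ⟨v, hv, hv0, w, hw⟩ := exists_joint_eigenvector (fun i => ρ (E i i)) hcomm
    (Module.End.eigenspace H (e + N)) hN (by
      intro i x hx
      rw [Module.End.mem_eigenspace_iff] at hx ⊢
      rw [hH, hE.gradingElt_apply ht ρ i i _ x hx]
      simp)
  refine ⟨v, hv0, w, ⟨fun i j hij => ?_, hw⟩⟩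
  by_contra hne
  have h1 := hE.gradingElt_apply ht ρ i j _ v (Module.End.mem_eigenspace_iff.mp hv)
  have h2 : H.HasEigenvalue (e + ((N + (j - i) : ℕ) : ℂ)) := by
    refine Module.End.hasEigenvalue_of_hasEigenvector (x := ρ (E i j) v)
      ⟨Module.End.mem_eigenspace_iff.mpr ?_, hne⟩
    rw [hH, h1]
    congr 1
    push_cast [Nat.cast_sub (Fin.lt_def.mp hij).le]
    ring
  have h3 := hmax h2 (by simp)
  have := Fin.lt_def.mp hij
  simp at h3
  omega

theorem IsHighestWeight.exists_nat [FiniteDimensional ℂ V] (hv : IsHighestWeight E ρ w v)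
    (hE : IsGlFamily t E) (ht : t ≠ 0) (hv0 : v ≠ 0) (i j : Fin n) (hij : i < j) :
    ∃ N : ℕ, w i - w j = t * N := by
  by_cases hw : w i = w j
  · exact ⟨0, by simp [hw]⟩
  have hne : i ≠ j := hij.ne
  have hρ : ∀ a b c d, ρ (E a b) * ρ (E c d) - ρ (E c d) * ρ (E a b) =
      t • ((if b = c then (1 : ℂ) else 0) • ρ (E a d)
        - (if a = d then (1 : ℂ) else 0) • ρ (E c b)) := by
    intro a b c d
    have := congrArg ρ (hE a b d c)
    simpa only [map_sub, map_mul, map_smul] using this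
  let _ : LieRing (Module.End ℂ V) := LieRing.ofAssociativeRing
  have triple : IsSl2Triple (t⁻¹ • (ρ (E i i) - ρ (E j j))) (t⁻¹ • ρ (E i j))
      (t⁻¹ • ρ (E j i)) := by
    refine ⟨?_, ?_, ?_, ?_⟩
    · intro h0
      have := congrArg (fun f => f v) h0
      simp only [LinearMap.smul_apply, LinearMap.sub_apply, hv.diag, LinearMap.zero_apply,
        ← sub_smul, smul_smul, smul_eq_zero, hv0, or_false, mul_eq_zero, inv_eq_zero, ht,
        false_or, sub_eq_zero] at this
      exact hw this
    · rw [Ring.lie_def, smul_mul_smul_comm, smul_mul_smul_comm, ← smul_sub, hρ]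
      simp [smul_smul, ht]
    · rw [Ring.lie_def, smul_mul_smul_comm, smul_mul_smul_comm, ← smul_sub, sub_mul, mul_sub,
        sub_sub_sub_comm, hρ, hρ]
      simp only [hne, hne.symm, if_true, if_false, one_smul, zero_smul]
      match_scalars
      field_simp
      norm_num
    · rw [Ring.lie_def, smul_mul_smul_comm, smul_mul_smul_comm, ← smul_sub, sub_mul, mul_sub,
        sub_sub_sub_comm, hρ, hρ]
      simp only [hne, hne.symm, if_true, if_false, one_smul, zero_smul]
      match_scalars
      field_simp
      norm_num
  have prim : triple.HasPrimitiveVectorWith v (t⁻¹ * (w i - w j)) := by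
    refine ⟨hv0, ?_, ?_⟩
    · change (t⁻¹ • (ρ (E i i) - ρ (E j j))) v = _
      simp [hv.diag, sub_smul, smul_smul, mul_sub, smul_sub]
    · change (t⁻¹ • ρ (E i j)) v = _
      simp [hv.raise i j hij]
  obtain ⟨N, hN⟩ := prim.exists_nat
  refine ⟨N, ?_⟩
  rw [← hN]
  field_simp

theorem IsHighestWeight.exists_strictMono [FiniteDimensional ℂ V] (hv : IsHighestWeight E ρ w v)
    (hE : IsGlFamily t E) (ht : t ≠ 0) (hv0 : v ≠ 0) (hn : 0 < n) :
    ∃ c : Fin n → ℕ, StrictMono c ∧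
      ∀ i, w i - t * (i : ℕ) = w ⟨0, hn⟩ - t * c i := by
  have h : ∀ i : Fin n, ∃ N : ℕ, w ⟨0, hn⟩ - w i = t * N := by
    intro i
    rcases eq_or_lt_of_le (Fin.le_def.mpr (Nat.zero_le i) : (⟨0, hn⟩ : Fin n) ≤ i) with h | h
    · exact ⟨0, by simp [← h]⟩
    · exact hv.exists_nat hE ht hv0 _ _ h
  choose N hN using h
  refine ⟨fun i => N i + i, ?_, ?_⟩
  · intro i j hij
    obtain ⟨M, hM⟩ := hv.exists_nat hE ht hv0 i j hij
    have : N j = N i + M := by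
      have h1 : t * (N j : ℂ) = t * (N i + M) := by
        rw [mul_add, ← hN, ← hN, ← hM]; ring
      exact_mod_cast mul_left_cancel₀ ht h1
    have := Fin.lt_def.mp hij
    simp only
    omega
  · intro i
    push_cast
    rw [mul_add, ← hN]
    ring

end Existence

section Combinatorics

theorem eq_of_map_eq {n : ℕ} {t a a' : ℂ} (ht : t ≠ 0) (hn : 0 < n) {l l' : Fin n → ℂ}
    {c c' : Fin n → ℕ} (hc : StrictMono c) (hc' : StrictMono c') (hl : ∀ i, l i = a - t * c i)
    (hl' : ∀ i, l' i = a' - t * c' i) (h0 : l ⟨0, hn⟩ = a) (h0' : l' ⟨0, hn⟩ = a')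
    (h : Finset.univ.val.map l = Finset.univ.val.map l') : l = l' := by
  have hmem : ∀ x, (∃ i, l i = x) ↔ ∃ i, l' i = x := by
    intro x
    have := congrArg (fun A : Multiset ℂ => x ∈ A) h
    simpa using this
  have ha : a = a' := by
    obtain ⟨i, hi⟩ := (hmem a).mp ⟨_, h0⟩
    obtain ⟨j, hj⟩ := (hmem a').mpr ⟨_, h0'⟩
    rw [hl'] at hi
    rw [hl] at hj
    have h1 : t * ((c j + c' i : ℕ) : ℂ) = 0 := by
      push_cast
      linear_combination -hi - hj
    have h2 : c j + c' i = 0 := by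
      exact_mod_cast (mul_eq_zero.mp h1).resolve_left ht
    have h3 : c' i = 0 := by omega
    rw [← hi, h3]
    simp
  subst ha
  have hr : Set.range c = Set.range c' := by
    ext x
    have := hmem (a - t * x)
    simpa [hl, hl', ht] using this
  have := (StrictMono.range_inj hc hc').mp hr
  funext i
  rw [hl, hl', this]

theorem exists_perm_of_stringUnion {n k : ℕ} {t a : ℂ} (ht : t ≠ 0) {l : Fin n → ℂ}
    {c : Fin n → ℕ} (hc : StrictMono c) (hl : ∀ i, l i = a - t * c i) {m : Fin k → ℕ}
    (hm : ∀ i, 0 < m i) {μ : Fin k → ℂ} (hμ : Function.Injective μ)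
    (h : Finset.univ.val.map l = stringUnion t m μ) :
    ∃ τ : Equiv.Perm (Fin k), ∀ (i : ℕ) (h : i + 1 < k), ∃ N : ℕ,
      (μ (τ ⟨i, Nat.lt_of_succ_lt h⟩) - μ (τ ⟨i + 1, h⟩)) / t
        - (m (τ ⟨i, Nat.lt_of_succ_lt h⟩) : ℂ) = (N : ℂ) := by
  classical
  have hmem : ∀ s, ∀ j < m s, μ s - t * (j : ℂ) ∈ stringUnion t m μ := by
    intro s j hj
    rw [stringUnion, Multiset.mem_sum]
    exact ⟨s, Finset.mem_univ s, Multiset.mem_map.mpr ⟨j, Multiset.mem_range.mpr hj, rfl⟩⟩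
  have hx : ∀ s, ∃ x : ℕ, μ s = a - t * x := by
    intro s
    have h1 := hmem s 0 (hm s)
    rw [← h] at h1
    obtain ⟨i, -, hi⟩ := Multiset.mem_map.mp h1
    exact ⟨c i, by rw [← hl, hi]; simp⟩
  choose x hx using hx
  have hxinj : Function.Injective x := fun s r hsr => hμ (by rw [hx, hx, hsr])
  have hnodup : (stringUnion t m μ).Nodup := by
    rw [← h]
    refine Multiset.Nodup.map ?_ Finset.univ.nodup
    intro i j hij
    rw [hl, hl] at hij
    exact hc.injective (by simpa [ht] using hij)
  have hsep : ∀ s r, x s < x r → x s + m s ≤ x r := by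
    intro s r hsr
    by_contra! hlt
    have hne : s ≠ r := by rintro rfl; exact hsr.false
    have h1 : μ r ∈ (Multiset.range (m s)).map fun j : ℕ => μ s - t * (j : ℂ) := by
      refine Multiset.mem_map.mpr ⟨x r - x s, Multiset.mem_range.mpr (by omega), ?_⟩
      rw [hx, hx, Nat.cast_sub hsr.le]
      ring
    have h2 : μ r ∈ (Multiset.range (m r)).map fun j : ℕ => μ r - t * (j : ℂ) :=
      Multiset.mem_map.mpr ⟨0, Multiset.mem_range.mpr (hm r), by simp⟩
    have h3 : 2 ≤ (stringUnion t m μ).count (μ r) := by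
      rw [stringUnion, Multiset.count_sum']
      calc 2 ≤ ∑ q ∈ {s, r}, ((Multiset.range (m q)).map fun j : ℕ => μ q - t * (j : ℂ)).count
            (μ r) := by
            rw [Finset.sum_pair hne]
            have := Multiset.one_le_count_iff_mem.mpr h1
            have := Multiset.one_le_count_iff_mem.mpr h2
            omega
        _ ≤ _ := Finset.sum_le_sum_of_subset (Finset.subset_univ _)
    have := Multiset.nodup_iff_count_le_one.mp hnodup (μ r)
    omega
  refine ⟨Tuple.sort x, fun i hi => ?_⟩
  have hmono : StrictMono (x ∘ Tuple.sort x) :=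
    (Tuple.monotone_sort x).strictMono_of_injective (hxinj.comp (Tuple.sort x).injective)
  have hlt := hsep _ _ (hmono (show (⟨i, Nat.lt_of_succ_lt hi⟩ : Fin k) < ⟨i + 1, hi⟩ by
    simp [Fin.lt_def]))
  refine ⟨x (Tuple.sort x ⟨i + 1, hi⟩) -
    (x (Tuple.sort x ⟨i, Nat.lt_of_succ_lt hi⟩) + m (Tuple.sort x ⟨i, Nat.lt_of_succ_lt hi⟩)), ?_⟩
  rw [Nat.cast_sub hlt, hx, hx]
  push_cast
  field_simp
  ring

end Combinatorics

section Spectrum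

variable {n : ℕ} {B : Type*} [Ring B] [Algebra ℂ B]
  {V : Type*} [AddCommGroup V] [Module ℂ V]
  {E : Fin n → Fin n → B} {ρ : B →ₐ[ℂ] Module.End ℂ V} {w : Fin n → ℂ} {v : V} {t : ℂ}

theorem IsHighestWeight.trace_apply (hv : IsHighestWeight E ρ w v) (hE : IsGlFamily t E) (r : ℕ) :
    ρ (∑ i, polyEntry E (Polynomial.X ^ r) i i) v =
      (∑ i, diagEigen t (fun i => w i - t * (i : ℕ)) r i) • v := by
  rw [map_sum, LinearMap.sum_apply, Finset.sum_smul]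
  exact Finset.sum_congr rfl fun i _ => hv.polyEntry_diag hE r i

theorem IsHighestWeight.map_eq_stringUnion (hv : IsHighestWeight E ρ w v) (hE : IsGlFamily t E)
    (ht : t ≠ 0) (hv0 : v ≠ 0) {k : ℕ} (m : Fin k → ℕ) (hsum : ∑ s, m s = n) (μ : Fin k → ℂ)
    (hprod : ∀ i j, ρ (polyEntry E (∏ s, (Polynomial.X - Polynomial.C (μ s))) i j) = 0)
    (htr : ∀ r ∈ Finset.Icc 1 (k - 1), ρ (∑ i, polyEntry E (Polynomial.X ^ r) i i) v =
      theta m μ t r • v) :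
    Finset.univ.val.map (fun i => w i - t * ((i : ℕ) : ℂ)) = stringUnion t m μ := by
  set l : Fin n → ℂ := fun i => w i - t * ((i : ℕ) : ℂ) with hl
  obtain ⟨f, hf⟩ : ∃ f : Module.Dual ℂ V, f v ≠ 0 := by
    by_contra! h
    exact hv0 ((Module.forall_dual_apply_eq_zero_iff ℂ v).mp h)
  let τ : Polynomial ℂ →ₗ[ℂ] ℂ :=
    { toFun := fun p => (f v)⁻¹ * f (ρ (∑ i, polyEntry E p i i) v)
      map_add' := fun p q => by
        simp only [polyEntry_add, Finset.sum_add_distrib, map_add, LinearMap.add_apply, mul_add]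
      map_smul' := fun a p => by
        simp only [polyEntry_smul, ← Finset.smul_sum, map_smul, LinearMap.smul_apply, smul_eq_mul,
          RingHom.id_apply]
        ring }
  have hτv : ∀ p c, ρ (∑ i, polyEntry E p i i) v = c • v → τ p = c := by
    intro p c h
    change (f v)⁻¹ * f (ρ (∑ i, polyEntry E p i i) v) = c
    rw [h, map_smul, smul_eq_mul, mul_comm c, inv_mul_cancel_left₀ hf]
  have hτX : ∀ r, τ (Polynomial.X ^ r) = ∑ i, diagEigen t l r i :=
    fun r => hτv _ _ (hv.trace_apply hE r)
  have hτP : ∀ r, τ (Polynomial.X ^ r * ∏ s, (Polynomial.X - Polynomial.C (μ s))) = 0 := by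
    intro r
    refine hτv _ _ ?_
    simp [polyEntry_mul, map_sum, hprod]
  have h1 := traceSeries_mul_prod t l
  have h2 := traceSeries_mul_prod_of_recurrence t μ _ τ _ hτP (thetaSeries_eq m μ t) (by
    intro r hr
    rcases r with _ | r
    · rw [hτX, theta_zero m μ t ht]
      simp [diagEigen, ← hsum]
    · exact hτv _ _ (htr _ (Finset.mem_Icc.mpr ⟨by omega, by omega⟩)))
  simp only [hτX] at h2
  exact _root_.map_eq_stringUnion ht l m μ _ h1 h2

end Spectrum

section Uniqueness

variable {n : ℕ} {B : Type*} [Ring B] [Algebra ℂ B] {t : ℂ} {E : Fin n → Fin n → B}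
  {w : Fin n → ℂ}

/-- A vector of the cyclic module generated by a highest weight vector `z`, with the same
grading as `z`, is a multiple of `z`. -/
theorem IsHighestWeight.exists_smul_of_mem_span {Z : Type*} [AddCommGroup Z] [Module ℂ Z]
    [Module B Z] [IsScalarTower ℂ B Z] {z : Z}
    (hz : IsHighestWeight E (Algebra.lsmul ℂ ℂ Z) w z) (hE : IsGlFamily t E) (ht : t ≠ 0)
    (hgen : Algebra.adjoin ℂ (Set.range fun p : Fin n × Fin n => E p.1 p.2) = ⊤)
    {x : Z} (hx : x ∈ Submodule.span B {z})
    (hxw : ∀ i, E i i • x = w i • x) : ∃ c : ℂ, x = c • z := by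
  set ρ : B →ₐ[ℂ] Module.End ℂ Z := Algebra.lsmul ℂ ℂ Z with hρ
  have hρa : ∀ (b : B) (y : Z), ρ b y = b • y := fun b y => rfl
  set H := ρ (gradingElt t E) with hH
  set h : ℂ := ∑ i : Fin n, (-((i : ℕ) : ℂ) / t) * w i with hh
  have hgrade : ∀ y : Z, (∀ i, E i i • y = w i • y) → H y = h • y := by
    intro y hy
    rw [hH, gradingElt, map_sum, LinearMap.sum_apply, hh, Finset.sum_smul]
    refine Finset.sum_congr rfl fun i _ => ?_
    rw [map_smul, LinearMap.smul_apply, hρa, hy, smul_smul]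
  let K : Submodule ℂ Z := ⨆ p : ℕ, Module.End.eigenspace H (h - (p + 1))
  let M₀ : Submodule ℂ Z := sInf {S | z ∈ S ∧ ∀ i j, j < i → ∀ y ∈ S, ρ (E i j) y ∈ S}
  have hM₀z : z ∈ M₀ := by
    rw [Submodule.mem_sInf]
    exact fun S hS => hS.1
  have hM₀low : ∀ i j, j < i → ∀ y ∈ M₀, ρ (E i j) y ∈ M₀ := by
    intro i j hij y hy
    rw [Submodule.mem_sInf] at hy ⊢
    exact fun S hS => hS.2 i j hij y (hy S hS)
  have hM₀le : ∀ S : Submodule ℂ Z, z ∈ S → (∀ i j, j < i → ∀ y ∈ S, ρ (E i j) y ∈ S) → M₀ ≤ S :=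
    fun S h1 h2 => sInf_le ⟨h1, h2⟩
  have hstable : ∀ a b, ∀ y ∈ M₀, ρ (E a b) y ∈ M₀ := by
    let S : Submodule ℂ Z := M₀ ⊓ ⨅ a, ⨅ b, M₀.comap (ρ (E a b))
    have hS : ∀ y, y ∈ S ↔ y ∈ M₀ ∧ ∀ a b, ρ (E a b) y ∈ M₀ := by
      intro y
      simp [S, Submodule.mem_iInf]
    have hle : M₀ ≤ S := by
      refine hM₀le S ?_ ?_
      · rw [hS]
        refine ⟨hM₀z, fun a b => ?_⟩
        rcases lt_trichotomy a b with hab | rfl | hab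
        · rw [hz.raise a b hab]; exact M₀.zero_mem
        · rw [hz.diag]; exact M₀.smul_mem _ hM₀z
        · exact hM₀low a b hab z hM₀z
      · intro i j hij y hy
        rw [hS] at hy ⊢
        refine ⟨hy.2 i j, fun a b => ?_⟩
        have h1 := congrArg (fun b => ρ b y) (hE a b j i)
        simp only [map_sub, map_mul, map_smul, LinearMap.sub_apply, Module.End.mul_apply,
          LinearMap.smul_apply] at h1
        rw [sub_eq_iff_eq_add] at h1
        rw [h1]
        exact M₀.add_mem (M₀.smul_mem _ (M₀.sub_mem (M₀.smul_mem _ (hy.2 _ _))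
          (M₀.smul_mem _ (hy.2 _ _)))) (hM₀low i j hij _ (hy.2 a b))
    exact fun a b y hy => ((hS y).mp (hle hy)).2 a b
  have hK : M₀ ≤ Submodule.span ℂ {z} ⊔ K := by
    refine hM₀le _ (Submodule.mem_sup_left (Submodule.mem_span_singleton_self z)) ?_
    intro i j hij
    have hle : Submodule.span ℂ {z} ⊔ K ≤ K.comap (ρ (E i j)) := by
      have hij' := Fin.lt_def.mp hij
      refine sup_le ?_ (iSup_le fun p y hy => ?_)
      · rw [Submodule.span_singleton_le_iff_mem]
        refine Submodule.mem_iSup_of_mem (i - j - 1 : ℕ) (Module.End.mem_eigenspace_iff.mpr ?_)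
        rw [hH, hE.gradingElt_apply ht ρ i j h z (hgrade z hz.diag)]
        congr 1
        rw [Nat.cast_sub (by omega), Nat.cast_sub hij'.le]
        push_cast; ring
      · refine Submodule.mem_iSup_of_mem (p + (i - j) : ℕ) (Module.End.mem_eigenspace_iff.mpr ?_)
        rw [hH, hE.gradingElt_apply ht ρ i j _ y (Module.End.mem_eigenspace_iff.mp hy)]
        congr 1
        push_cast [Nat.cast_sub hij'.le]; ring
    exact fun y hy => Submodule.mem_sup_right (hle hy)
  have hmem : ∀ b : B, ∀ y ∈ M₀, b • y ∈ M₀ := by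
    intro b
    have hb : b ∈ Algebra.adjoin ℂ (Set.range fun p : Fin n × Fin n => E p.1 p.2) := by
      rw [hgen]; exact Algebra.mem_top
    induction hb using Algebra.adjoin_induction with
    | mem b hb =>
      obtain ⟨p, rfl⟩ := hb
      exact hstable p.1 p.2
    | algebraMap c =>
      intro y hy
      rw [algebraMap_smul]
      exact M₀.smul_mem c hy
    | add a b _ _ ha hb => intro y hy; rw [add_smul]; exact M₀.add_mem (ha y hy) (hb y hy)
    | mul a b _ _ ha hb => intro y hy; rw [mul_smul]; exact ha _ (hb y hy)
  obtain ⟨b, rfl⟩ := Submodule.mem_span_singleton.mp hx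
  obtain ⟨y, hy, u, hu, hyu⟩ := Submodule.mem_sup.mp (hK (hmem b z hM₀z))
  obtain ⟨c, rfl⟩ := Submodule.mem_span_singleton.mp hy
  refine ⟨c, ?_⟩
  have hu1 : u ∈ Module.End.eigenspace H h := by
    have : u = b • z - c • z := by rw [← hyu]; abel
    rw [this]
    exact Submodule.sub_mem _ (Module.End.mem_eigenspace_iff.mpr (hgrade _ hxw))
      (Submodule.smul_mem _ _ (Module.End.mem_eigenspace_iff.mpr (hgrade _ hz.diag)))
  have hKle : K ≤ ⨆ j, ⨆ (_ : j ≠ h), Module.End.eigenspace H j := by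
    refine iSup_le fun p => le_iSup₂_of_le (h - (p + 1)) ?_ le_rfl
    intro hp
    have : ((p + 1 : ℕ) : ℂ) = 0 := by push_cast; linear_combination -hp
    exact absurd this (Nat.cast_ne_zero.mpr (Nat.succ_ne_zero p))
  have hu0 := (Module.End.eigenspaces_iSupIndep H h).le_bot ⟨hu1, hKle hu⟩
  rw [Submodule.mem_bot] at hu0
  rw [← hyu, hu0, add_zero]

theorem nonempty_linearEquiv_of_isHighestWeight {V W : Type*} [AddCommGroup V] [Module ℂ V]
    [Module B V] [IsScalarTower ℂ B V] [AddCommGroup W] [Module ℂ W]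
    [Module B W] [IsScalarTower ℂ B W] [IsSimpleModule B V] [IsSimpleModule B W]
    (hE : IsGlFamily t E) (ht : t ≠ 0)
    (hgen : Algebra.adjoin ℂ (Set.range fun p : Fin n × Fin n => E p.1 p.2) = ⊤)
    {v : V} {u : W} (hv0 : v ≠ 0) (hu0 : u ≠ 0)
    (hv : IsHighestWeight E (Algebra.lsmul ℂ ℂ V) w v)
    (hu : IsHighestWeight E (Algebra.lsmul ℂ ℂ W) w u) : Nonempty (V ≃ₗ[B] W) := by
  have hvd : ∀ i, E i i • v = w i • v := hv.diag
  have hud : ∀ i, E i i • u = w i • u := hu.diag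
  have hz : IsHighestWeight E (Algebra.lsmul ℂ ℂ (V × W)) w (v, u) :=
    ⟨fun i j hij => Prod.ext (hv.raise i j hij) (hu.raise i j hij),
      fun i => Prod.ext (hv.diag i) (hu.diag i)⟩
  set N := Submodule.span B {(v, u)} with hN
  have hzN : (v, u) ∈ N := Submodule.mem_span_singleton_self _
  have hnl : (v, (0 : W)) ∉ N := by
    intro hmem
    obtain ⟨c, hc⟩ := hz.exists_smul_of_mem_span hE ht hgen hmem
      (fun i => Prod.ext (hvd i) (by simp))
    simp only [Prod.smul_mk, Prod.mk.injEq] at hc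
    rcases smul_eq_zero.mp hc.2.symm with h | h
    · exact hv0 (by rw [hc.1, h, zero_smul])
    · exact hu0 h
  have hnr : ((0 : V), u) ∉ N := by
    intro hmem
    obtain ⟨c, hc⟩ := hz.exists_smul_of_mem_span hE ht hgen hmem
      (fun i => Prod.ext (by simp) (hud i))
    simp only [Prod.smul_mk, Prod.mk.injEq] at hc
    rcases smul_eq_zero.mp hc.1.symm with h | h
    · exact hu0 (by rw [hc.2, h, zero_smul])
    · exact hv0 h
  let p₁ : N →ₗ[B] V := (LinearMap.fst B V W).comp N.subtype
  let p₂ : N →ₗ[B] W := (LinearMap.snd B V W).comp N.subtype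
  have hs₁ : Function.Surjective p₁ := by
    refine LinearMap.surjective_of_ne_zero fun h => hv0 ?_
    exact congrArg (fun f => f ⟨_, hzN⟩) h
  have hs₂ : Function.Surjective p₂ := by
    refine LinearMap.surjective_of_ne_zero fun h => hu0 ?_
    exact congrArg (fun f => f ⟨_, hzN⟩) h
  have hi₁ : Function.Injective p₁ := by
    rw [injective_iff_map_eq_zero]
    rintro ⟨⟨x, y⟩, hxy⟩ (rfl : x = 0)
    rcases eq_bot_or_eq_top (N.comap (LinearMap.inr B V W)) with h | h
    · have : y ∈ N.comap (LinearMap.inr B V W) := hxy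
      rw [h, Submodule.mem_bot] at this
      subst this
      rfl
    · have : u ∈ N.comap (LinearMap.inr B V W) := by rw [h]; trivial
      exact absurd this hnr
  have hi₂ : Function.Injective p₂ := by
    rw [injective_iff_map_eq_zero]
    rintro ⟨⟨x, y⟩, hxy⟩ (rfl : y = 0)
    rcases eq_bot_or_eq_top (N.comap (LinearMap.inl B V W)) with h | h
    · have : x ∈ N.comap (LinearMap.inl B V W) := hxy
      rw [h, Submodule.mem_bot] at this
      subst this
      rfl
    · have : v ∈ N.comap (LinearMap.inl B V W) := by rw [h]; trivial
      exact absurd this hnl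
  exact ⟨(LinearEquiv.ofBijective p₁ ⟨hi₁, hs₁⟩).symm.trans
    (LinearEquiv.ofBijective p₂ ⟨hi₂, hs₂⟩)⟩

end Uniqueness

section DerivationDet

variable {R : Type*} [CommRing R] [Algebra ℂ R]

theorem Derivation.prod_eq_zero (D : Derivation ℂ R R) {ι : Type*} (s : Finset ι) (f : ι → R)
    (h : ∀ i ∈ s, D (f i) = 0) : D (∏ i ∈ s, f i) = 0 := by
  classical
  induction s using Finset.induction_on with
  | empty => simp
  | insert a s ha ih =>
    rw [Finset.prod_insert ha, D.leibniz, h a (Finset.mem_insert_self a s),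
      ih fun i hi => h i (Finset.mem_insert_of_mem hi)]
    simp

theorem Derivation.det_eq_zero (D : Derivation ℂ R R) {ι : Type*} [Fintype ι] [DecidableEq ι]
    (A : Matrix ι ι R) (h : ∀ a b, D (A a b) = 0) : D A.det = 0 := by
  rw [Matrix.det_apply, map_sum]
  refine Finset.sum_eq_zero fun σ _ => ?_
  rw [Units.smul_def, map_zsmul, D.prod_eq_zero _ _ fun i _ => h _ _, smul_zero]

theorem Derivation.det_eq_det_updateRow (D : Derivation ℂ R R) {ι : Type*} [Fintype ι]
    [DecidableEq ι] (A : Matrix ι ι R) (j : ι) (h : ∀ a b, a ≠ j → D (A a b) = 0) :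
    D A.det = (A.updateRow j fun b => D (A j b)).det := by
  rw [Matrix.det_apply, Matrix.det_apply, map_sum]
  refine Finset.sum_congr rfl fun σ _ => ?_
  have h1 : ∀ i ∈ Finset.univ.erase (σ.symm j), σ i ≠ j := by
    intro i hi hij
    exact Finset.ne_of_mem_erase hi (by rw [← hij, σ.symm_apply_apply])
  rw [Units.smul_def, Units.smul_def, map_zsmul]
  congr 1
  rw [← Finset.mul_prod_erase _ _ (Finset.mem_univ (σ.symm j)),
    ← Finset.mul_prod_erase _ _ (Finset.mem_univ (σ.symm j)), D.leibniz,
    D.prod_eq_zero _ _ fun i hi => h _ _ (h1 i hi), smul_zero, zero_add, smul_eq_mul, mul_comm,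
    Matrix.updateRow_apply, if_pos (σ.apply_symm_apply j), σ.apply_symm_apply]
  congr 1
  exact Finset.prod_congr rfl fun i hi => by rw [Matrix.updateRow_apply, if_neg (h1 i hi)]

theorem Derivation.prod_pow_eigen (D : Derivation ℂ R R) {ι : Type*} (s : Finset ι) (f : ι → R)
    (N : ι → ℕ) (c : ι → ℂ) (h : ∀ i ∈ s, D (f i) = c i • f i) :
    D (∏ i ∈ s, f i ^ N i) = (∑ i ∈ s, N i * c i) • ∏ i ∈ s, f i ^ N i := by
  classical
  have hp : ∀ a x : R, ∀ z : ℂ, ∀ r : ℕ, a = z • x → D x = a → D (x ^ r) = (r * z) • x ^ r := by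
    intro a x z r ha hD
    rw [D.leibniz_pow, hD, ha]
    rcases r with _ | r
    · simp
    · rw [Nat.add_sub_cancel, smul_eq_mul, mul_smul_comm, ← pow_succ, ← Nat.cast_smul_eq_nsmul ℂ,
        smul_smul]
  induction s using Finset.induction_on with
  | empty => simp
  | insert a s ha ih =>
    rw [Finset.prod_insert ha, Finset.sum_insert ha, D.leibniz,
      ih fun i hi => h i (Finset.mem_insert_of_mem hi),
      hp _ _ _ (N a) (h a (Finset.mem_insert_self a s)) rfl]
    simp only [smul_eq_mul, mul_smul_comm, add_smul]
    rw [add_comm, mul_comm (∏ i ∈ s, _)]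

end DerivationDet

section Polarization

variable {n : ℕ}

/-- The polarization operator replacing the variables of the row `j` by those of the row `i`. -/
def polarization (i j : Fin n) : Derivation ℂ (MvPolynomial (Fin n × Fin n) ℂ)
    (MvPolynomial (Fin n × Fin n) ℂ) :=
  MvPolynomial.mkDerivation ℂ fun p => if p.1 = j then MvPolynomial.X (i, p.2) else 0

theorem polarization_X (i j a b : Fin n) :
    polarization i j (MvPolynomial.X (a, b)) = if a = j then MvPolynomial.X (i, b) else 0 := by
  simp [polarization]

theorem polarization_lie (i j l m : Fin n) :
    ⁅polarization i j, polarization m l⁆ =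
      (if j = m then (1 : ℂ) else 0) • polarization i l
        - (if i = l then (1 : ℂ) else 0) • polarization m j := by
  refine MvPolynomial.derivation_ext fun ⟨a, b⟩ => ?_
  simp only [Derivation.commutator_apply, polarization_X, Derivation.sub_apply,
    Derivation.smul_apply]
  simp only [apply_ite (polarization _ _), map_zero, polarization_X]
  split_ifs <;> subst_vars <;> first | contradiction | simp

theorem polarization_mem_restrictTotalDegree (i j : Fin n) (d : ℕ)
    {p : MvPolynomial (Fin n × Fin n) ℂ}
    (hp : p ∈ MvPolynomial.restrictTotalDegree (Fin n × Fin n) ℂ d) :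
    polarization i j p ∈ MvPolynomial.restrictTotalDegree (Fin n × Fin n) ℂ d := by
  rw [p.as_sum, map_sum]
  refine Submodule.sum_mem _ fun s hs => ?_
  rw [MvPolynomial.mem_restrictTotalDegree] at hp
  have hsd : s.degree ≤ d := (MvPolynomial.le_totalDegree hs).trans hp
  rw [polarization, MvPolynomial.mkDerivation_monomial]
  refine Submodule.smul_mem _ _ (Submodule.sum_mem _ fun q hq => ?_)
  dsimp only
  split_ifs
  · rw [MvPolynomial.mem_restrictTotalDegree, smul_eq_mul]
    refine (MvPolynomial.totalDegree_mul _ _).trans ?_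
    rw [MvPolynomial.totalDegree_X]
    have h1 : (s - Finsupp.single q 1).degree + 1 = s.degree := by
      have h2 : s - Finsupp.single q 1 + Finsupp.single q 1 = s :=
        tsub_add_cancel_of_le (Finsupp.single_le_iff.mpr
          (Nat.one_le_iff_ne_zero.mpr (Finsupp.mem_support_iff.mp hq)))
      conv_rhs => rw [← h2]
      simp [map_add]
    have h2 := MvPolynomial.totalDegree_monomial_le (s - Finsupp.single q 1) ((s q : ℕ) : ℂ)
    have h3 : ((s - Finsupp.single q 1).sum fun _ => id) = (s - Finsupp.single q 1).degree := rfl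
    omega
  · simp

/-- The minor of the generic matrix on its first `q` rows and columns. -/
def principalMinor (n q : ℕ) (hq : q ≤ n) : MvPolynomial (Fin n × Fin n) ℂ :=
  (Matrix.of fun a b : Fin q =>
    (MvPolynomial.X (Fin.castLE hq a, Fin.castLE hq b) : MvPolynomial (Fin n × Fin n) ℂ)).det

theorem principalMinor_ne_zero {q : ℕ} (hq : q ≤ n) : principalMinor n q hq ≠ 0 := by
  intro h
  have h1 := congrArg
    (MvPolynomial.eval fun p : Fin n × Fin n => if p.1 = p.2 then (1 : ℂ) else 0) h
  rw [principalMinor, RingHom.map_det, map_zero] at h1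
  have h2 : (MvPolynomial.eval fun p : Fin n × Fin n => if p.1 = p.2 then (1 : ℂ) else 0).mapMatrix
      (Matrix.of fun a b : Fin q =>
        (MvPolynomial.X (Fin.castLE hq a, Fin.castLE hq b) : MvPolynomial (Fin n × Fin n) ℂ)) =
      1 := by
    ext a b
    simp [Matrix.one_apply]
  rw [h2, Matrix.det_one] at h1
  exact one_ne_zero h1

theorem polarization_principalMinor {q : ℕ} (hq : q ≤ n) (i j : Fin n)
    (h : (j : ℕ) < q → (i : ℕ) < q) :
    polarization i j (principalMinor n q hq) =
      (if i = j ∧ (i : ℕ) < q then (1 : ℂ) else 0) • principalMinor n q hq := by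
  by_cases hj : (j : ℕ) < q
  · set A := Matrix.of fun a b : Fin q =>
      (MvPolynomial.X (Fin.castLE hq a, Fin.castLE hq b) : MvPolynomial (Fin n × Fin n) ℂ) with hA
    have hD : ∀ a b, polarization i j (A a b) = if a = ⟨j, hj⟩ then A ⟨i, h hj⟩ b else 0 := by
      intro a b
      simp only [hA, Matrix.of_apply, polarization_X]
      congr 1
      simp [Fin.ext_iff]
    rw [principalMinor, ← hA, Derivation.det_eq_det_updateRow _ A ⟨j, hj⟩ fun a b hab => by
      rw [hD, if_neg hab]]
    simp only [hD, if_true]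
    by_cases hij : i = j
    · subst hij
      simp [hj]
    · rw [if_neg fun h => hij h.1, zero_smul]
      refine Matrix.det_zero_of_row_eq (i := ⟨j, hj⟩) (j := ⟨i, h hj⟩)
        (fun he => hij (Fin.ext (Fin.ext_iff.mp he).symm)) ?_
      funext b
      rw [Matrix.updateRow_apply, Matrix.updateRow_apply, if_pos rfl, ite_self]
  · rw [if_neg (by rintro ⟨rfl, h⟩; exact hj ‹_›), zero_smul, principalMinor]
    refine Derivation.det_eq_zero _ _ fun a b => ?_
    rw [Matrix.of_apply, polarization_X, if_neg]
    rintro rfl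
    exact hj (by simp)

/-- The family `t • polarization + t * c` of operators on polynomials. -/
def shiftedPolarization (n : ℕ) (t c : ℂ) (i j : Fin n) :
    Module.End ℂ (MvPolynomial (Fin n × Fin n) ℂ) :=
  t • (polarization i j : MvPolynomial (Fin n × Fin n) ℂ →ₗ[ℂ] MvPolynomial (Fin n × Fin n) ℂ)
    + (if i = j then t * c else 0) • 1

theorem shiftedPolarization_apply (t c : ℂ) (i j : Fin n) (p : MvPolynomial (Fin n × Fin n) ℂ) :
    shiftedPolarization n t c i j p =
      t • polarization i j p + (if i = j then t * c else 0) • p := by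
  simp only [shiftedPolarization, LinearMap.add_apply, LinearMap.smul_apply, Module.End.one_apply]
  rfl

theorem isGlFamily_shiftedPolarization (t c : ℂ) : IsGlFamily t (shiftedPolarization n t c) := by
  intro i j l m
  refine LinearMap.ext fun p => ?_
  have h := congrArg (fun D => D p) (polarization_lie i j l m)
  simp only [Derivation.commutator_apply, Derivation.sub_apply, Derivation.smul_apply] at h
  simp only [LinearMap.sub_apply, Module.End.mul_apply, LinearMap.smul_apply,
    shiftedPolarization_apply, map_add, Derivation.map_smul, smul_add]
  rw [sub_eq_iff_eq_add.mp h]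
  have h1 : (if j = m then (1 : ℂ) else 0) * (if i = l then t * c else 0) =
      (if i = l then (1 : ℂ) else 0) * (if m = j then t * c else 0) := by
    by_cases h1 : m = j <;> by_cases h2 : i = l <;> simp [h1, h2, Ne.symm]
  generalize (if j = m then (1 : ℂ) else 0) = a, (if i = l then t * c else 0) = b,
    (if i = l then (1 : ℂ) else 0) = d, (if m = j then t * c else 0) = e at h1 ⊢
  have h2 : (d * e) • p = (a * b) • p := by rw [h1]
  linear_combination (norm := module) t • h2

end Polarization

section MinorProducts

variable {n : ℕ}

theorem exists_isHighestWeight_shiftedPolarization {ι : Type*} (s : Finset ι) (Q : ι → ℕ)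
    (hQ : ∀ r, Q r ≤ n) (N : ι → ℕ) (t c : ℂ) :
    ∃ v : MvPolynomial (Fin n × Fin n) ℂ, v ≠ 0 ∧
      IsHighestWeight (shiftedPolarization n t c)
        (AlgHom.id ℂ (Module.End ℂ (MvPolynomial (Fin n × Fin n) ℂ)))
        (fun i => t * ((∑ r ∈ s, if (i : ℕ) < Q r then (N r : ℂ) else 0) + c)) v ∧
      ∀ i j : Fin n, i ≠ j → (∀ r ∈ s, (j : ℕ) < Q r → (i : ℕ) < Q r) →
        shiftedPolarization n t c i j v = 0 := by
  set v : MvPolynomial (Fin n × Fin n) ℂ := ∏ r ∈ s, principalMinor n (Q r) (hQ r) ^ N r with hv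
  have key : ∀ i j : Fin n, (∀ r ∈ s, (j : ℕ) < Q r → (i : ℕ) < Q r) → polarization i j v =
      (∑ r ∈ s, N r * (if i = j ∧ (i : ℕ) < Q r then (1 : ℂ) else 0)) • v := fun i j h =>
    (polarization i j).prod_pow_eigen s _ N _ fun r hr =>
      polarization_principalMinor (hQ r) i j (h r hr)
  have hoff : ∀ i j : Fin n, i ≠ j → (∀ r ∈ s, (j : ℕ) < Q r → (i : ℕ) < Q r) →
      shiftedPolarization n t c i j v = 0 := by
    intro i j hij h
    rw [shiftedPolarization_apply, key i j h]
    simp [hij]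
  refine ⟨v, Finset.prod_ne_zero_iff.mpr fun r _ => pow_ne_zero _ (principalMinor_ne_zero _),
    ⟨fun i j hij => hoff i j hij.ne fun r _ h => (Fin.lt_def.mp hij).trans h, fun i => ?_⟩, hoff⟩
  rw [AlgHom.id_apply, shiftedPolarization_apply, key i i fun r _ h => h, if_pos rfl, smul_smul,
    ← add_smul, mul_add]
  simp

end MinorProducts

section Vanishing

variable {n : ℕ} {B : Type*} [Ring B] [Algebra ℂ B]
  {V : Type*} [AddCommGroup V] [Module ℂ V]
  {E : Fin n → Fin n → B} {ρ : B →ₐ[ℂ] Module.End ℂ V} {w : Fin n → ℂ} {v : V} {t : ℂ}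

theorem polyEntry_mul_X_sub_C_apply (p : Polynomial ℂ) (a : ℂ) (i j : Fin n) (x : V) :
    ρ (polyEntry E (p * (Polynomial.X - Polynomial.C a)) i j) x =
      ∑ α, ρ (polyEntry E p α j) (ρ (E i α) x) - a • ρ (polyEntry E p i j) x := by
  rw [mul_sub, polyEntry_sub, map_sub, LinearMap.sub_apply, polyEntry_mul_X_apply,
    mul_comm p, ← Polynomial.smul_eq_C_mul, polyEntry_smul, map_smul, LinearMap.smul_apply]

theorem IsHighestWeight.polyEntry_prod_eq_zero (hv : IsHighestWeight E ρ w v)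
    (hE : IsGlFamily t E) {k : ℕ} (Q : ℕ → ℕ) (hQ0 : Q 0 = 0)
    (hQn : ∀ s, s ≤ k → Q s ≤ n) (μ : ℕ → ℂ)
    (hlow : ∀ s < k, ∀ i j : Fin n, Q s ≤ j → j < i → (i : ℕ) < Q (s + 1) → ρ (E i j) v = 0)
    (hw : ∀ s < k, ∀ i : Fin n, Q s ≤ i → (i : ℕ) < Q (s + 1) → w i = μ s + t * Q s) :
    ∀ s ≤ k, ∀ i : Fin n, (i : ℕ) < Q s → ∀ j,
      ρ (polyEntry E (∏ r ∈ Finset.range s, (Polynomial.X - Polynomial.C (μ r))) i j) v = 0 := by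
  intro s
  induction s with
  | zero =>
    intro _ i hi
    omega
  | succ s ih =>
    intro hs i hi j
    have ih := ih (Nat.le_of_succ_le hs)
    rw [Finset.prod_range_succ]
    set P := ∏ r ∈ Finset.range s, (Polynomial.X - Polynomial.C (μ r)) with hP
    rcases lt_or_ge (i : ℕ) (Q s) with hi' | hi'
    · rw [polyEntry_mul, map_sum, LinearMap.sum_apply]
      refine Finset.sum_eq_zero fun α _ => ?_
      rw [map_mul, Module.End.mul_apply, ih i hi', map_zero]
    · rw [polyEntry_mul_X_sub_C_apply]
      have h1 : ∀ α, ρ (polyEntry E P α j) (ρ (E i α) v) =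
          (if α = i then w i else 0) • ρ (polyEntry E P i j) v
            - (if (α : ℕ) < Q s then t else 0) • ρ (polyEntry E P i j) v := by
        intro α
        rcases lt_trichotomy α i with h | rfl | h
        · rcases lt_or_ge (α : ℕ) (Q s) with hα | hα
          · rw [hE.polyEntry_apply, ih α hα, ih α hα]
            simp [hα, h.ne]
          · rw [hlow s hs i α hα h hi, map_zero]
            simp [hα.not_gt, h.ne]
        · rw [hv.diag, map_smul]
          simp [hi'.not_gt]
        · have h2 : ¬ (α : ℕ) < Q s := by have := Fin.lt_def.mp h; omega
          rw [hv.raise i α h, map_zero]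
          simp [h2, h.ne']
      have h2 : ∑ α : Fin n, (if (α : ℕ) < Q s then t else 0) = t * Q s := by
        rw [Finset.sum_ite, Finset.sum_const_zero, add_zero, Finset.sum_const,
          Fin.card_filter_val_lt, min_eq_right (hQn s (Nat.le_of_succ_le hs))]
        simp [mul_comm]
      simp only [h1]
      rw [Finset.sum_sub_distrib, ← Finset.sum_smul, ← Finset.sum_smul, h2, Finset.sum_ite_eq',
        if_pos (Finset.mem_univ i), hw s hs i hi' hi]
      module

end Vanishing

section Trace

theorem univ_map_eq_stringUnion {k : ℕ} (t : ℂ) (m : ℕ → ℕ) (μ : ℕ → ℂ) (l : ℕ → ℂ)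
    (h : ∀ s < k, ∀ j < m s, l (∑ r ∈ Finset.range s, m r + j) = μ s - t * j) :
    (Multiset.range (∑ r ∈ Finset.range k, m r)).map l =
      stringUnion t (fun s : Fin k => m s) fun s => μ s := by
  induction k with
  | zero => simp [stringUnion]
  | succ k ih =>
    rw [Finset.sum_range_succ, Multiset.range_add, Multiset.map_add,
      ih fun s hs => h s (hs.trans k.lt_succ_self), stringUnion, stringUnion, Fin.sum_univ_castSucc,
      Multiset.map_map]
    congr 1
    exact Multiset.map_congr rfl fun j hj => h k k.lt_succ_self j (Multiset.mem_range.mp hj)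

theorem linFactor_ne_zero (a : ℂ) : linFactor a ≠ 0 := by
  intro h
  have := congrArg (PowerSeries.coeff 0) h
  simp [linFactor] at this

theorem sum_diagEigen_eq_theta {n k : ℕ} {t : ℂ} (ht : t ≠ 0) (l : Fin n → ℂ) (m : Fin k → ℕ)
    (μ : Fin k → ℂ) (h : Finset.univ.val.map l = stringUnion t m μ) (r : ℕ) :
    ∑ i, diagEigen t l r i = theta m μ t r := by
  have h1 := traceSeries_mul_prod t l
  have h2 := thetaSeries_eq m μ t
  have h3 := congrArg (fun A => (A.map linFactor).prod) (stringUnion_telescope t m μ)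
  simp only [← h, Multiset.map_add, Multiset.prod_add, Multiset.map_map] at h3
  have h4 : (∏ s, linFactor (μ s)) * ∏ i, linFactor (l i - t) =
    (∏ s, linFactor (μ s - t * m s)) * ∏ i, linFactor (l i) := h3
  have h5 : (∏ s, linFactor (μ s)) * ∏ i, linFactor (l i) ≠ 0 :=
    mul_ne_zero (Finset.prod_ne_zero_iff.mpr fun _ _ => linFactor_ne_zero _)
      (Finset.prod_ne_zero_iff.mpr fun _ _ => linFactor_ne_zero _)
  rw [← h1, ← h2] at h4
  have h6 := mul_right_cancel₀ h5 (show (1 + PowerSeries.C t * PowerSeries.X *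
    PowerSeries.mk fun r => ∑ i, diagEigen t l r i) * _ = (1 + PowerSeries.C t * PowerSeries.X *
    PowerSeries.mk (theta m μ t)) * _ by linear_combination h4)
  have h7 := congrArg (PowerSeries.coeff (r + 1)) (add_left_cancel h6)
  rw [mul_assoc, mul_assoc, PowerSeries.coeff_C_mul, PowerSeries.coeff_C_mul,
    PowerSeries.coeff_succ_X_mul, PowerSeries.coeff_succ_X_mul, PowerSeries.coeff_mk,
    PowerSeries.coeff_mk] at h7
  exact mul_left_cancel₀ ht h7

end Trace

section OrbitVector

theorem exists_orbit_vector {n k : ℕ} (hk : 1 ≤ k) {t : ℂ} (ht : t ≠ 0) (m : Fin k → ℕ)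
    (hsum : ∑ i, m i = n) (μ : Fin k → ℂ) (τ : Equiv.Perm (Fin k))
    (h : ∀ (i : ℕ) (h : i + 1 < k), ∃ N : ℕ,
      (μ (τ ⟨i, Nat.lt_of_succ_lt h⟩) - μ (τ ⟨i + 1, h⟩)) / t
        - (m (τ ⟨i, Nat.lt_of_succ_lt h⟩) : ℂ) = (N : ℂ)) :
    ∃ (c : ℂ) (v : MvPolynomial (Fin n × Fin n) ℂ), v ≠ 0 ∧
      (∀ i j, polyEntry (shiftedPolarization n t c)
        (∏ s, (Polynomial.X - Polynomial.C (μ s))) i j v = 0) ∧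
      ∀ r, (∑ i, polyEntry (shiftedPolarization n t c) (Polynomial.X ^ r) i i) v =
        theta m μ t r • v := by
  choose N hN using h
  set μ' : ℕ → ℂ := fun r => if hr : r < k then μ (τ ⟨r, hr⟩) else 0 with hμ'
  set m' : ℕ → ℕ := fun r => if hr : r < k then m (τ ⟨r, hr⟩) else 0 with hm'
  set N' : ℕ → ℕ := fun r => if hr : r + 1 < k then N r hr else 0 with hN'
  set Q : ℕ → ℕ := fun s => ∑ r ∈ Finset.range s, m' r with hQ
  have hμs : ∀ s : Fin k, μ' s = μ (τ s) := fun s => by simp [hμ']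
  have hms : ∀ s : Fin k, m' s = m (τ s) := fun s => by simp [hm']
  have hQs : ∀ s, Q (s + 1) = Q s + m' s := fun s => Finset.sum_range_succ _ _
  have hQmono : Monotone Q := monotone_nat_of_le_succ fun s => by rw [hQs]; omega
  have hQk : Q k = n := by
    rw [← hsum, ← Equiv.sum_comp τ]
    refine (Finset.sum_range _).trans ?_
    exact Finset.sum_congr rfl fun s _ => hms s
  have hstep : ∀ r, r + 1 < k → t * N' r = (μ' r + t * Q r) - (μ' (r + 1) + t * Q (r + 1)) := by
    intro r hr
    have h1 := hN r hr
    rw [sub_eq_iff_eq_add, div_eq_iff ht] at h1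
    have h2 : μ' r = μ (τ ⟨r, Nat.lt_of_succ_lt hr⟩) := dif_pos _
    have h3 : μ' (r + 1) = μ (τ ⟨r + 1, hr⟩) := dif_pos _
    have h4 : m' r = m (τ ⟨r, Nat.lt_of_succ_lt hr⟩) := dif_pos _
    have h5 : N' r = N r hr := dif_pos _
    rw [hQs, h2, h3, h4, h5]
    push_cast
    linear_combination -h1
  set c := (μ' (k - 1) + t * Q (k - 1)) / t with hc
  have hcn : t * c = μ' (k - 1) + t * Q (k - 1) := mul_div_cancel₀ _ ht
  obtain ⟨v, hv0, hv, hlow⟩ := exists_isHighestWeight_shiftedPolarization (n := n)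
    (Finset.range (k - 1)) (fun r => min (Q (r + 1)) n) (fun r => min_le_right _ _) N' t c
  have hQ' : ∀ r ∈ Finset.range (k - 1), min (Q (r + 1)) n = Q (r + 1) := by
    intro r hr
    have := Finset.mem_range.mp hr
    exact min_eq_left ((hQmono (show r + 1 ≤ k by omega)).trans hQk.le)
  set w : Fin n → ℂ := fun i => t * ((∑ r ∈ Finset.range (k - 1),
    if (i : ℕ) < min (Q (r + 1)) n then (N' r : ℂ) else 0) + c) with hw
  have hwval : ∀ s < k, ∀ i : Fin n, Q s ≤ i → (i : ℕ) < Q (s + 1) → w i = μ' s + t * Q s := by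
    intro s hs i hi hi'
    have h1 : ∑ r ∈ Finset.range (k - 1), (if (i : ℕ) < min (Q (r + 1)) n then (N' r : ℂ) else 0) =
        ∑ r ∈ Finset.Ico s (k - 1), (N' r : ℂ) := by
      rw [← Finset.sum_filter]
      refine Finset.sum_congr ?_ fun _ _ => rfl
      ext r
      rw [Finset.mem_filter, Finset.mem_Ico, and_comm]
      refine and_congr_left_iff.mpr ?_ |>.trans (by rw [Finset.mem_range])
      intro hr
      rw [hQ' r hr]
      refine ⟨fun h => ?_, fun h => hi'.trans_le (hQmono (by omega))⟩
      by_contra hrs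
      have := hQmono (show r + 1 ≤ s by omega)
      omega
    have h2 : t * ∑ r ∈ Finset.Ico s (k - 1), (N' r : ℂ) =
        (μ' s + t * Q s) - (μ' (k - 1) + t * Q (k - 1)) := by
      rw [Finset.mul_sum, ← neg_sub (μ' (k - 1) + _),
        ← Finset.sum_Ico_sub (fun r => μ' r + t * Q r) (show s ≤ k - 1 by omega),
        ← Finset.sum_neg_distrib]
      refine Finset.sum_congr rfl fun r hr => ?_
      rw [hstep r (by have := (Finset.mem_Ico.mp hr).2; omega), neg_sub]
    rw [hw]
    dsimp only
    rw [h1, mul_add, h2, hcn]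
    ring
  have hE := isGlFamily_shiftedPolarization (n := n) t c
  refine ⟨c, v, hv0, ?_, ?_⟩
  · intro i j
    have h1 := hv.polyEntry_prod_eq_zero hE (k := k) Q (by simp [hQ])
      (fun s hs => (hQmono hs).trans hQk.le) μ' (fun s hs i j hj hji hi => ?_) hwval k le_rfl i
      (by rw [hQk]; exact i.2) j
    · rw [← Equiv.prod_comp τ]
      rw [Finset.prod_range] at h1
      simpa only [hμs, AlgHom.id_apply] using h1
    · refine hlow i j hji.ne' fun r hr hjr => ?_
      rw [hQ' r hr] at hjr ⊢
      refine hi.trans_le (hQmono ?_)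
      by_contra hrs
      have := hQmono (show r + 1 ≤ s by omega)
      omega
  · intro r
    have h1 := hv.trace_apply hE r
    rw [AlgHom.id_apply] at h1
    rw [h1, sum_diagEigen_eq_theta ht _ m μ ?_]
    set l : ℕ → ℂ := fun i => if hi : i < n then w ⟨i, hi⟩ - t * i else 0 with hl
    have h2 := univ_map_eq_stringUnion (k := k) t m' μ' l ?_
    · have h3 : stringUnion t m μ = stringUnion t (fun s : Fin k => m' s) fun s => μ' s := by
        rw [stringUnion, stringUnion, ← Equiv.sum_comp τ]
        simp only [hμs, hms]
      rw [h3, ← h2]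
      change _ = (Multiset.range (Q k)).map l
      have h4 : Multiset.range n = Finset.univ.val.map (fun i : Fin n => (i : ℕ)) := by
        simp [Fin.univ_val_map, Multiset.range, List.ofFn_eq_map]
      rw [hQk, h4, Multiset.map_map]
      exact Multiset.map_congr rfl fun i _ => by simp [hl]
    · intro s hs j hj
      change l (Q s + j) = _
      have h3 : Q s + j < Q (s + 1) := by rw [hQs]; omega
      have h4 : Q s + j < n := h3.trans_le ((hQmono (show s + 1 ≤ k by omega)).trans hQk.le)
      rw [hl]
      dsimp only
      rw [dif_pos h4, hwval s hs ⟨Q s + j, h4⟩ (Nat.le_add_right _ _) h3]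
      push_cast
      ring

end OrbitVector

section Transport

variable {n : ℕ}

theorem map_polyEntry {B B' : Type*} [Ring B] [Algebra ℂ B] [Ring B'] [Algebra ℂ B']
    (φ : B →ₐ[ℂ] B') (E : Fin n → Fin n → B) (p : Polynomial ℂ) :
    ∀ i j, φ (polyEntry E p i j) = polyEntry (fun a b => φ (E a b)) p i j := by
  induction p using Polynomial.induction_on with
  | C a => intro i j; rw [polyEntry_C, polyEntry_C]; split_ifs <;> simp
  | add p q hp hq => intro i j; simp only [polyEntry_add, map_add, hp, hq]
  | monomial r a h =>
    intro i j
    simp only [pow_succ, ← mul_assoc, polyEntry_mul_X _ (Polynomial.C a * Polynomial.X ^ r),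
      map_sum, map_mul, h]

theorem IsGlFamily.map {B B' : Type*} [Ring B] [Algebra ℂ B] [Ring B'] [Algebra ℂ B'] {t : ℂ}
    {E : Fin n → Fin n → B} (hE : IsGlFamily t E) (φ : B →ₐ[ℂ] B') :
    IsGlFamily t fun i j => φ (E i j) := by
  intro i j l m
  have h := congrArg φ (hE i j l m)
  simpa only [map_sub, map_mul, map_smul] using h

theorem polyEntry_intertwine {V W : Type*} [AddCommGroup V] [Module ℂ V] [AddCommGroup W]
    [Module ℂ W] (f : V →ₗ[ℂ] W) (E : Fin n → Fin n → Module.End ℂ V)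
    (F : Fin n → Fin n → Module.End ℂ W) (h : ∀ i j x, f (E i j x) = F i j (f x))
    (p : Polynomial ℂ) : ∀ i j x, f (polyEntry E p i j x) = polyEntry F p i j (f x) := by
  induction p using Polynomial.induction_on with
  | C a => intro i j x; rw [polyEntry_C, polyEntry_C]; split_ifs <;> simp
  | add p q hp hq => intro i j x; simp only [polyEntry_add, LinearMap.add_apply, map_add, hp, hq]
  | monomial r a ih =>
    intro i j x
    simp only [pow_succ, ← mul_assoc, polyEntry_mul_X _ (Polynomial.C a * Polynomial.X ^ r),
      LinearMap.sum_apply, map_sum, Module.End.mul_apply, ih, h]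

end Transport

section Presentation

variable {n k : ℕ} {t : ℂ} {m : Fin k → ℕ} {μ : Fin k → ℂ}

theorem isGlFamily_EgenC (n : ℕ) (t : ℂ) : IsGlFamily t (EgenC n t) := by
  intro i j l m
  have h := RingQuot.mkAlgHom_rel ℂ (glRelC.comm (n := n) (t := t) i j l m)
  simp only [map_sub, map_mul, map_smul] at h
  exact h

theorem prodEC_eq_polyEntry (n k : ℕ) (t : ℂ) (μ : Fin k → ℂ) (i j : Fin n) :
    prodEC n k t μ i j =
      polyEntry (EgenC n t) (∏ s, (Polynomial.X - Polynomial.C (μ s))) i j := by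
  rw [polyEntry, ← List.prod_ofFn, map_list_prod, List.map_ofFn, prodEC, Matrix.of_apply]
  have h : (fun s => EmatOpC n t - algebraMap ℂ (Matrix (Fin n) (Fin n) (Uc n t)ᵐᵒᵖ) (μ s)) =
      Polynomial.aeval (Matrix.of fun i j => op (EgenC n t i j)) ∘ fun s =>
        Polynomial.X - Polynomial.C (μ s) := by
    funext s
    simp [EmatOpC]
  rw [h]

theorem trEC_eq_sum_polyEntry (n : ℕ) (t : ℂ) (r : ℕ) :
    trEC n t r = ∑ i, polyEntry (EgenC n t) (Polynomial.X ^ r) i i := by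
  simp [trEC, polyEntry, Matrix.trace, EmatOpC, Finset.unop_sum]

/-- The quotient map from `U_t`. -/
def toAlgC (n k : ℕ) (t : ℂ) (m : Fin k → ℕ) (μ : Fin k → ℂ) : Uc n t →ₐ[ℂ] AlgC n k t m μ :=
  RingQuot.mkAlgHom ℂ (fun a b : Uc n t => a - b ∈ genSetC n k t m μ)

/-- The images of the generators in `A_{m,μ,t}`. -/
def algGen (n k : ℕ) (t : ℂ) (m : Fin k → ℕ) (μ : Fin k → ℂ) (i j : Fin n) : AlgC n k t m μ :=
  toAlgC n k t m μ (EgenC n t i j)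

theorem toAlgC_eq_zero {u : Uc n t} (hu : u ∈ genSetC n k t m μ) : toAlgC n k t m μ u = 0 := by
  have h := RingQuot.mkAlgHom_rel ℂ (s := fun a b : Uc n t => a - b ∈ genSetC n k t m μ)
    (x := u) (y := 0) (by rwa [sub_zero])
  exact h.trans (map_zero _)

theorem isGlFamily_algGen : IsGlFamily t (algGen n k t m μ) :=
  (isGlFamily_EgenC n t).map (toAlgC n k t m μ)

theorem polyEntry_algGen_prod (i j : Fin n) :
    polyEntry (algGen n k t m μ) (∏ s, (Polynomial.X - Polynomial.C (μ s))) i j = 0 := by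
  refine (map_polyEntry (toAlgC n k t m μ) _ _ i j).symm.trans ?_
  rw [← prodEC_eq_polyEntry]
  exact toAlgC_eq_zero (Or.inl ⟨i, j, rfl⟩)

theorem sum_polyEntry_algGen (r : ℕ) (hr : r ∈ Finset.Icc 1 (k - 1)) :
    ∑ i, polyEntry (algGen n k t m μ) (Polynomial.X ^ r) i i =
      algebraMap ℂ (AlgC n k t m μ) (theta m μ t r) := by
  have h : toAlgC n k t m μ (trEC n t r - algebraMap ℂ _ (theta m μ t r)) = 0 :=
    toAlgC_eq_zero (Or.inr ⟨r, hr, rfl⟩)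
  rw [map_sub, AlgHom.commutes, sub_eq_zero, trEC_eq_sum_polyEntry, map_sum] at h
  rw [← h]
  exact Finset.sum_congr rfl fun i _ => (map_polyEntry (toAlgC n k t m μ) _ _ i i).symm

theorem adjoin_range_algGen :
    Algebra.adjoin ℂ (Set.range fun p : Fin n × Fin n => algGen n k t m μ p.1 p.2) = ⊤ := by
  set φ : FAc n →ₐ[ℂ] AlgC n k t m μ :=
    (toAlgC n k t m μ).comp (RingQuot.mkAlgHom ℂ (glRelC n t)) with hφ
  have h1 : (Set.range fun p : Fin n × Fin n => algGen n k t m μ p.1 p.2) =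
      φ '' Set.range (FreeAlgebra.ι ℂ) := by
    rw [← Set.range_comp]
    rfl
  rw [h1, ← AlgHom.map_adjoin, FreeAlgebra.adjoin_range_ι, Algebra.map_top,
    AlgHom.range_eq_top]
  exact (RingQuot.mkAlgHom_surjective ℂ _).comp (RingQuot.mkAlgHom_surjective ℂ _)

theorem exists_algHom_AlgC {A : Type*} [Ring A] [Algebra ℂ A] {F : Fin n → Fin n → A}
    (hF : IsGlFamily t F)
    (hprod : ∀ i j, polyEntry F (∏ s, (Polynomial.X - Polynomial.C (μ s))) i j = 0)
    (htr : ∀ r ∈ Finset.Icc 1 (k - 1),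
      ∑ i, polyEntry F (Polynomial.X ^ r) i i = algebraMap ℂ A (theta m μ t r)) :
    Nonempty (AlgC n k t m μ →ₐ[ℂ] A) := by
  let φ : Uc n t →ₐ[ℂ] A := RingQuot.liftAlgHom ℂ
    ⟨FreeAlgebra.lift ℂ fun p : Fin n × Fin n => F p.1 p.2, by
      rintro _ _ ⟨i, j, l, m⟩
      simpa only [map_sub, map_mul, map_smul, FreeAlgebra.lift_ι_apply] using hF i j l m⟩
  have hφ : (fun i j => φ (EgenC n t i j)) = F := by
    funext i j
    simp [φ, EgenC]
  have h0 : ∀ u ∈ genSetC n k t m μ, φ u = 0 := by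
    rintro u (⟨i, j, rfl⟩ | ⟨r, hr, rfl⟩)
    · rw [prodEC_eq_polyEntry, map_polyEntry, hφ, hprod]
    · rw [map_sub, trEC_eq_sum_polyEntry, map_sum, AlgHom.commutes, ← htr r hr, sub_eq_zero]
      exact Finset.sum_congr rfl fun i _ => by rw [map_polyEntry, hφ]
  exact ⟨RingQuot.liftAlgHom ℂ ⟨φ, fun {x y} h => sub_eq_zero.mp (by
    rw [← map_sub]; exact h0 _ h)⟩⟩

end Presentation

section FiniteDimensional

theorem exists_rep_of_orbit_vector {n k : ℕ} {t c : ℂ} {m : Fin k → ℕ} {μ : Fin k → ℂ}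
    {v : MvPolynomial (Fin n × Fin n) ℂ} (hv0 : v ≠ 0)
    (hprod : ∀ i j, polyEntry (shiftedPolarization n t c)
      (∏ s, (Polynomial.X - Polynomial.C (μ s))) i j v = 0)
    (htr : ∀ r, (∑ i, polyEntry (shiftedPolarization n t c) (Polynomial.X ^ r) i i) v =
      theta m μ t r • v) :
    ∃ (V : Type) (_ : AddCommGroup V) (_ : Module ℂ V),
      FiniteDimensional ℂ V ∧ Nontrivial V ∧
        Nonempty (AlgC n k t m μ →ₐ[ℂ] Module.End ℂ V) := by
  set E := shiftedPolarization n t c with hEdef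
  have hE : IsGlFamily t E := isGlFamily_shiftedPolarization t c
  have hcomm : ∀ p i j a b x, polyEntry E p a b (E i j x) = E i j (polyEntry E p a b x)
      - t • ((if j = a then (1 : ℂ) else 0) • polyEntry E p i b x
        - (if i = b then (1 : ℂ) else 0) • polyEntry E p a j x) := fun p i j a b x =>
    hE.polyEntry_apply (AlgHom.id ℂ _) p i j a b x
  set P := polyEntry E (∏ s, (Polynomial.X - Polynomial.C (μ s))) with hP
  let Z : Submodule ℂ (MvPolynomial (Fin n × Fin n) ℂ) :=
    (⨅ i, ⨅ j, LinearMap.ker (P i j)) ⊓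
      ⨅ r, LinearMap.ker ((∑ i, polyEntry E (Polynomial.X ^ r) i i) - theta m μ t r • 1)
  have hZ : ∀ x, x ∈ Z ↔ (∀ i j, P i j x = 0) ∧
      ∀ r, (∑ i, polyEntry E (Polynomial.X ^ r) i i) x = theta m μ t r • x := by
    intro x
    simp [Z, Submodule.mem_iInf, sub_eq_zero]
  let N : Submodule ℂ (MvPolynomial (Fin n × Fin n) ℂ) :=
    Z ⊓ MvPolynomial.restrictTotalDegree (Fin n × Fin n) ℂ v.totalDegree
  have hstab : ∀ i j, ∀ x ∈ N, E i j x ∈ N := by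
    rintro i j x ⟨hx, hxd⟩
    rw [SetLike.mem_coe, hZ] at hx
    refine ⟨(hZ _).mpr ⟨fun a b => ?_, fun r => ?_⟩, ?_⟩
    · rw [hP, hcomm, ← hP, hx.1, hx.1, hx.1]
      simp
    · rw [LinearMap.sum_apply, ← map_smul, ← hx.2 r, LinearMap.sum_apply, map_sum]
      simp only [hcomm]
      rw [Finset.sum_sub_distrib, ← Finset.smul_sum, Finset.sum_sub_distrib]
      simp
    · rw [hEdef, shiftedPolarization_apply]
      exact Submodule.add_mem _ (Submodule.smul_mem _ _
        (polarization_mem_restrictTotalDegree i j _ hxd)) (Submodule.smul_mem _ _ hxd)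
  have hvN : v ∈ N := ⟨(hZ v).mpr ⟨hprod, htr⟩,
    (MvPolynomial.mem_restrictTotalDegree _ _ _).mpr le_rfl⟩
  let F : Fin n → Fin n → Module.End ℂ N := fun i j => (E i j).restrict (hstab i j)
  have hsub : ∀ p i j (x : N), ((polyEntry F p i j x : N) : MvPolynomial (Fin n × Fin n) ℂ) =
      polyEntry E p i j x := fun p i j x =>
    polyEntry_intertwine N.subtype F E (fun _ _ _ => rfl) p i j x
  have hfin : FiniteDimensional ℂ N := Submodule.finiteDimensional_of_le inf_le_right
  refine ⟨N, inferInstance, inferInstance, hfin,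
    ⟨⟨v, hvN⟩, 0, fun h => hv0 (congrArg Subtype.val h)⟩, exists_algHom_AlgC (F := F) ?_ ?_ ?_⟩
  · intro i j l m
    refine LinearMap.ext fun x => Subtype.ext ?_
    have h := congrArg (fun f => f (x : MvPolynomial (Fin n × Fin n) ℂ)) (hE i j l m)
    exact h
  · intro i j
    refine LinearMap.ext fun x => Subtype.ext ?_
    rw [hsub]
    exact ((hZ x).mp x.2.1).1 i j
  · intro r _
    refine LinearMap.ext fun x => Subtype.ext ?_
    have h := ((hZ x).mp x.2.1).2 r
    rw [LinearMap.sum_apply] at h ⊢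
    rw [Submodule.coe_sum]
    simp only [hsub]
    exact h

end FiniteDimensional

section Classification

variable {n k : ℕ} {t : ℂ} {m : Fin k → ℕ} {μ : Fin k → ℂ}

theorem exists_isHighestWeight_algGen (hn : 0 < n) (ht : t ≠ 0) (hsum : ∑ i, m i = n)
    {V : Type*} [AddCommGroup V] [Module ℂ V] [FiniteDimensional ℂ V] [Nontrivial V]
    (ρ : AlgC n k t m μ →ₐ[ℂ] Module.End ℂ V) :
    ∃ v ≠ 0, ∃ w, IsHighestWeight (algGen n k t m μ) ρ w v ∧
      Finset.univ.val.map (fun i => w i - t * ((i : ℕ) : ℂ)) = stringUnion t m μ ∧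
      ∃ c : Fin n → ℕ, StrictMono c ∧ ∀ i, w i - t * ((i : ℕ) : ℂ) = w ⟨0, hn⟩ - t * c i := by
  have hE : IsGlFamily t (algGen n k t m μ) := isGlFamily_algGen
  obtain ⟨v, hv0, w, hv⟩ := exists_isHighestWeight hE ht ρ
  refine ⟨v, hv0, w, hv, hv.map_eq_stringUnion hE ht hv0 m hsum μ (fun i j => ?_)
    (fun r hr => ?_), hv.exists_strictMono hE ht hv0 hn⟩
  · rw [polyEntry_algGen_prod, map_zero]
  · rw [sum_polyEntry_algGen r hr, AlgHom.commutes, Module.algebraMap_end_apply]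

theorem exists_simple_module {V : Type} [AddCommGroup V] [Module ℂ V] [FiniteDimensional ℂ V]
    [Nontrivial V] {A : Type*} [Ring A] [Algebra ℂ A] (ρ : A →ₐ[ℂ] Module.End ℂ V) :
    ∃ (W : Type) (_ : AddCommGroup W) (_ : Module ℂ W) (_ : Module A W)
      (_ : IsScalarTower ℂ A W), FiniteDimensional ℂ W ∧ IsSimpleModule A W := by
  let _ : Module A V := Module.compHom V (ρ : A →+* Module.End ℂ V)
  have : IsScalarTower ℂ A V := ⟨fun a b x => by
    change ρ (a • b) x = a • ρ b x
    rw [map_smul, LinearMap.smul_apply]⟩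
  have : IsArtinian A V := isArtinian_of_tower ℂ inferInstance
  obtain ⟨N, hN⟩ := IsAtomic.exists_atom (Submodule A V)
  exact ⟨N, inferInstance, inferInstance, inferInstance, inferInstance,
    FiniteDimensional.of_injective (N.subtype.restrictScalars ℂ) N.injective_subtype,
    isSimpleModule_iff_isAtom.mpr hN⟩

theorem nonempty_linearEquiv_algC (hn : 0 < n) (ht : t ≠ 0) (hsum : ∑ i, m i = n)
    {V W : Type*} [AddCommGroup V] [Module ℂ V] [Module (AlgC n k t m μ) V]
    [IsScalarTower ℂ (AlgC n k t m μ) V] [AddCommGroup W] [Module ℂ W]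
    [Module (AlgC n k t m μ) W] [IsScalarTower ℂ (AlgC n k t m μ) W]
    [FiniteDimensional ℂ V] [IsSimpleModule (AlgC n k t m μ) V]
    [FiniteDimensional ℂ W] [IsSimpleModule (AlgC n k t m μ) W] :
    Nonempty (V ≃ₗ[AlgC n k t m μ] W) := by
  have : Nontrivial V := IsSimpleModule.nontrivial (AlgC n k t m μ) V
  have : Nontrivial W := IsSimpleModule.nontrivial (AlgC n k t m μ) W
  obtain ⟨v, hv0, w, hv, hl, c, hc, hlc⟩ := exists_isHighestWeight_algGen hn ht hsum
    (Algebra.lsmul ℂ ℂ V : AlgC n k t m μ →ₐ[ℂ] _)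
  obtain ⟨u, hu0, w', hu, hl', c', hc', hlc'⟩ := exists_isHighestWeight_algGen hn ht hsum
    (Algebra.lsmul ℂ ℂ W : AlgC n k t m μ →ₐ[ℂ] _)
  have h := eq_of_map_eq ht hn hc hc' hlc hlc' (by simp) (by simp) (hl.trans hl'.symm)
  obtain rfl : w = w' := funext fun i => sub_left_injective (congrFun h i)
  exact nonempty_linearEquiv_of_isHighestWeight isGlFamily_algGen ht adjoin_range_algGen
    hv0 hu0 hv hu

end Classification

/-- the quantum orbit `A_{m,μ,t}` (for `t ≠ 0`) admits a nonzero
finite-dimensional representation iff the integrality conditions hold for some permutation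
`τ`; moreover in that case it has, up to isomorphism, exactly one irreducible
finite-dimensional module. -/
theorem statement7 (n k : ℕ) (hn : 1 ≤ n) (hk : 1 ≤ k) (hkn : k ≤ n)
    (t : ℂ) (ht : t ≠ 0)
    (m : Fin k → ℕ) (hm : ∀ i, 0 < m i) (hsum : ∑ i, m i = n)
    (μ : Fin k → ℂ) (hμ : Function.Injective μ) :
    ((∃ (V : Type) (_ : AddCommGroup V) (_ : Module ℂ V),
        FiniteDimensional ℂ V ∧ Nontrivial V ∧
          Nonempty (AlgC n k t m μ →ₐ[ℂ] Module.End ℂ V)) ↔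
      ∃ τ : Equiv.Perm (Fin k), ∀ (i : ℕ) (h : i + 1 < k), ∃ N : ℕ,
        (μ (τ ⟨i, Nat.lt_of_succ_lt h⟩) - μ (τ ⟨i + 1, h⟩)) / t
            - (m (τ ⟨i, Nat.lt_of_succ_lt h⟩) : ℂ) = (N : ℂ)) ∧
    ((∃ (V : Type) (_ : AddCommGroup V) (_ : Module ℂ V),
        FiniteDimensional ℂ V ∧ Nontrivial V ∧
          Nonempty (AlgC n k t m μ →ₐ[ℂ] Module.End ℂ V)) →
      (∃ (V : Type) (_ : AddCommGroup V) (_ : Module ℂ V)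
          (_ : Module (AlgC n k t m μ) V) (_ : IsScalarTower ℂ (AlgC n k t m μ) V),
          FiniteDimensional ℂ V ∧ IsSimpleModule (AlgC n k t m μ) V) ∧
      (∀ (V W : Type) (_ : AddCommGroup V) (_ : Module ℂ V)
          (_ : Module (AlgC n k t m μ) V) (_ : IsScalarTower ℂ (AlgC n k t m μ) V)
          (_ : AddCommGroup W) (_ : Module ℂ W)
          (_ : Module (AlgC n k t m μ) W) (_ : IsScalarTower ℂ (AlgC n k t m μ) W),
          FiniteDimensional ℂ V → IsSimpleModule (AlgC n k t m μ) V →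
          FiniteDimensional ℂ W → IsSimpleModule (AlgC n k t m μ) W →
            Nonempty (V ≃ₗ[AlgC n k t m μ] W))) := by
  refine ⟨⟨?_, ?_⟩, ?_⟩
  · rintro ⟨V, _, _, _, _, ⟨ρ⟩⟩
    obtain ⟨v, -, w, -, hl, c, hc, hlc⟩ := exists_isHighestWeight_algGen hn ht hsum ρ
    exact exists_perm_of_stringUnion ht hc hlc hm hμ hl
  · rintro ⟨τ, hτ⟩
    obtain ⟨c, v, hv0, hprod, htr⟩ := exists_orbit_vector hk ht m hsum μ τ hτ
    exact exists_rep_of_orbit_vector hv0 hprod htr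
  · rintro ⟨V, _, _, _, _, ⟨ρ⟩⟩
    refine ⟨exists_simple_module ρ, ?_⟩
    intro V W _ _ _ _ _ _ _ _ _ _ _ _
    exact nonempty_linearEquiv_algC hn ht hsum

end
end

section
/- Let m = (m₁,…,m_k) be positive integers summing to n, let μ ∈ ℂ^k, and define ν_i = μ_i + (n − m_i)·t ∈ ℂ[t] for i = 1,…,k. Then the two-sided ideals I_{m,μ,t} and I°_{m,ν,t} of U(g_t) coincide; consequently the identity on the generators E^i_j induces an algebra isomorphism A_{m,μ,t} ≅ A°_{m,ν,t}. -/
noncomputable section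

open Polynomial MulOpposite

section Moments

variable {K M : Type*} [CommRing K] [AddCommGroup M] [Module K M]

/-- The `K`-linear map on polynomials sending `X ^ n` to `a n`. -/
def momentMap (a : ℕ → M) : K[X] →ₗ[K] M :=
  Polynomial.lsum fun n => LinearMap.toSpanSingleton K M (a n)

@[simp]
lemma momentMap_X_pow (a : ℕ → M) (n : ℕ) : momentMap a (X ^ n : K[X]) = a n := by
  simp [momentMap, Polynomial.lsum_apply, ← Polynomial.monomial_one_right_eq_X_pow]

@[simp]
lemma momentMap_one (a : ℕ → M) : momentMap a (1 : K[X]) = a 0 := by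
  simpa using momentMap_X_pow (K := K) a 0

lemma momentMap_apply_eq_sum (a : ℕ → M) {f : K[X]} {k : ℕ} (hf : f.natDegree < k) :
    momentMap a f = ∑ i ∈ Finset.range k, f.coeff i • a i := by
  rw [momentMap, Polynomial.lsum_apply, Polynomial.sum_over_range' _ (by simp) _ hf]
  simp

lemma linearMap_ext_X_pow {f g : K[X] →ₗ[K] M} (h : ∀ n, f (X ^ n) = g (X ^ n)) : f = g := by
  refine Polynomial.lhom_ext' fun n => LinearMap.ext_ring ?_
  simpa [Polynomial.monomial_one_right_eq_X_pow] using h n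

lemma momentMap_congr {a b : ℕ → M} {f : K[X]} {k : ℕ} (hf : f.natDegree < k)
    (h : ∀ i < k, a i = b i) : momentMap a f = momentMap b f := by
  rw [momentMap_apply_eq_sum a hf, momentMap_apply_eq_sum b hf]
  exact Finset.sum_congr rfl fun i hi => by rw [h i (Finset.mem_range.1 hi)]

lemma map_momentMap {N : Type*} [AddCommGroup N] [Module K N] (g : M →ₗ[K] N) (a : ℕ → M)
    (f : K[X]) : g (momentMap a f) = momentMap (fun n => g (a n)) f := by
  have : g ∘ₗ momentMap a = momentMap (K := K) fun n => g (a n) :=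
    linearMap_ext_X_pow fun n => by simp
  exact LinearMap.congr_fun this f

lemma linearMap_eq_momentMap (g : K[X] →ₗ[K] M) : g = momentMap fun n => g (X ^ n) :=
  linearMap_ext_X_pow fun n => by simp

end Moments

section ThetaSeries

variable {K ι : Type*} [CommRing K] (τ : K) (m : ι → ℕ)

/-- The series `∏ j ∈ S, (1 + τ m_j w / (1 - μ_j w))` in the variable `w`. -/
def thetaSeries (μ : ι → K) (S : Finset ι) : PowerSeries K :=
  ∏ j ∈ S, (1 + PowerSeries.C (τ * m j) *
    (PowerSeries.X * PowerSeries.mk fun d => μ j ^ d))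

lemma one_sub_mul_geometric (a : K) :
    (1 - PowerSeries.C a * PowerSeries.X) * (PowerSeries.mk fun d => a ^ d) = 1 := by
  ext n
  cases n with
  | zero => simp
  | succ n =>
    simp [sub_mul, mul_assoc, PowerSeries.coeff_succ_X_mul, PowerSeries.coeff_one, pow_succ']

lemma one_sub_mul_thetaFactor (a b : K) :
    (1 - PowerSeries.C a * PowerSeries.X) *
      (1 + PowerSeries.C b * (PowerSeries.X * PowerSeries.mk fun d => a ^ d)) =
      1 - PowerSeries.C (a - b) * PowerSeries.X := by
  have h := one_sub_mul_geometric a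
  rw [map_sub]
  linear_combination (PowerSeries.C b * PowerSeries.X) * h

@[simp]
lemma coeff_zero_thetaSeries (μ : ι → K) (S : Finset ι) :
    PowerSeries.coeff 0 (thetaSeries τ m μ S) = 1 := by
  simp [thetaSeries, map_prod]

lemma one_sub_mul_thetaSeries_insert [DecidableEq ι] (μ : ι → K) {S : Finset ι} {j : ι}
    (hj : j ∉ S) :
    (1 - PowerSeries.C (μ j) * PowerSeries.X) * thetaSeries τ m μ (insert j S) =
      (1 - PowerSeries.C (μ j - τ * m j) * PowerSeries.X) * thetaSeries τ m μ S := by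
  rw [thetaSeries, Finset.prod_insert hj, ← mul_assoc, one_sub_mul_thetaFactor, thetaSeries]

lemma coeff_thetaSeries_insert [DecidableEq ι] (μ : ι → K) {S : Finset ι} {j : ι}
    (hj : j ∉ S) (n : ℕ) :
    PowerSeries.coeff (n + 1) (thetaSeries τ m μ (insert j S)) -
        μ j * PowerSeries.coeff n (thetaSeries τ m μ (insert j S)) =
      PowerSeries.coeff (n + 1) (thetaSeries τ m μ S) -
        (μ j - τ * m j) * PowerSeries.coeff n (thetaSeries τ m μ S) := by
  have h := congrArg (PowerSeries.coeff (n + 1)) (one_sub_mul_thetaSeries_insert τ m μ hj)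
  simpa only [sub_mul, one_mul, mul_assoc, map_sub, PowerSeries.coeff_C_mul,
    PowerSeries.coeff_succ_X_mul] using h

/-- The linear functional on polynomials with moments `τ θ_n`. -/
def thetaFunctional (μ : ι → K) (S : Finset ι) : K[X] →ₗ[K] K :=
  momentMap fun n => PowerSeries.coeff (n + 1) (thetaSeries τ m μ S)

lemma thetaFunctional_insert [DecidableEq ι] (μ : ι → K) {S : Finset ι} {j : ι}
    (hj : j ∉ S) (f : K[X]) :
    thetaFunctional τ m μ (insert j S) ((X - C (μ j)) * f) =
      thetaFunctional τ m μ S ((X - C (μ j)) * f) + τ * m j * thetaFunctional τ m μ S f := by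
  have : (thetaFunctional τ m μ (insert j S)) ∘ₗ LinearMap.mulLeft K (X - C (μ j)) =
      (thetaFunctional τ m μ S) ∘ₗ LinearMap.mulLeft K (X - C (μ j)) +
        (τ * m j) • thetaFunctional τ m μ S := by
    refine linearMap_ext_X_pow fun n => ?_
    have h := coeff_thetaSeries_insert τ m μ hj (n + 1)
    simp only [LinearMap.comp_apply, LinearMap.mulLeft_apply, LinearMap.add_apply,
      LinearMap.smul_apply, sub_mul, ← pow_succ', ← smul_eq_C_mul, map_sub, map_smul,
      thetaFunctional, momentMap_X_pow, smul_eq_mul]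
    linear_combination h
  simpa using LinearMap.congr_fun this f

lemma thetaFunctional_one (μ : ι → K) (S : Finset ι) :
    thetaFunctional τ m μ S 1 = τ * ∑ j ∈ S, (m j : K) := by
  classical
  induction S using Finset.induction_on with
  | empty => simp [thetaFunctional, thetaSeries, PowerSeries.coeff_one]
  | insert j S hj ih =>
    have h := coeff_thetaSeries_insert τ m μ hj 0
    simp only [thetaFunctional, momentMap_one] at ih ⊢
    simp only [coeff_zero_thetaSeries] at h
    rw [Finset.sum_insert hj]
    linear_combination h + ih

lemma thetaFunctional_prod_mul (μ : ι → K) (S : Finset ι) (f : K[X]) :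
    thetaFunctional τ m μ S ((∏ j ∈ S, (X - C (μ j))) * f) = 0 := by
  classical
  induction S using Finset.induction_on generalizing f with
  | empty =>
    have : thetaFunctional τ m μ ∅ = 0 :=
      linearMap_ext_X_pow fun n => by simp [thetaFunctional, thetaSeries, PowerSeries.coeff_one]
    simp [this]
  | insert j S hj ih =>
    rw [Finset.prod_insert hj, mul_assoc, thetaFunctional_insert τ m μ hj, ih, mul_left_comm, ih]
    simp

lemma thetaFunctional_comp_X_add_C (μ : ι → K) (S : Finset ι) (c : K) (f : K[X]) :
    thetaFunctional τ m μ S (f.comp (X + C c)) =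
      thetaFunctional τ m (fun j => μ j + c) S f := by
  classical
  induction S using Finset.induction_on generalizing f with
  | empty =>
    have : ∀ μ : ι → K, thetaFunctional τ m μ ∅ = 0 := fun μ =>
      linearMap_ext_X_pow fun n => by simp [thetaFunctional, thetaSeries, PowerSeries.coeff_one]
    simp [this]
  | insert j S hj ih =>
    obtain ⟨g, v, rfl⟩ : ∃ g : K[X], ∃ v : K, f = (X - C (μ j + c)) * g + C v := by
      refine ⟨f /ₘ (X - C (μ j + c)), f.eval (μ j + c), ?_⟩
      rw [← Polynomial.modByMonic_X_sub_C_eq_C_eval, add_comm, Polynomial.modByMonic_add_div]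
    have hX : ((X - C (μ j + c)) * g).comp (X + C c) = (X - C (μ j)) * g.comp (X + C c) := by
      simp [Polynomial.mul_comp, C_add]
    have hins := thetaFunctional_insert τ m (fun j => μ j + c) hj g
    have hv : (C v : K[X]) = v • 1 := by simp [smul_eq_C_mul]
    rw [Polynomial.add_comp, hX, Polynomial.C_comp, map_add, map_add,
      thetaFunctional_insert τ m μ hj, hins, ← ih, ← ih, hX, hv, map_smul, map_smul,
      thetaFunctional_one, thetaFunctional_one]

/-- The polynomials `∑ i + j = n, T_i X ^ j` for a power series `T`. -/
def convPoly (T : PowerSeries K) (n : ℕ) : K[X] :=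
  ∑ p ∈ Finset.HasAntidiagonal.antidiagonal n, C (PowerSeries.coeff p.1 T) * X ^ p.2

lemma convPoly_succ (T : PowerSeries K) (n : ℕ) :
    convPoly T (n + 1) = convPoly T n * X + C (PowerSeries.coeff (n + 1) T) := by
  rw [convPoly, Finset.Nat.sum_antidiagonal_succ', convPoly, Finset.sum_mul, add_comm]
  simp [pow_succ, mul_assoc]

lemma momentMap_convPoly_thetaSeries (μ : ι → K) (S : Finset ι) :
    momentMap (convPoly (thetaSeries τ m μ S)) (∏ j ∈ S, (X - C (μ j))) =
      ∏ j ∈ S, (X - C (μ j - τ * m j)) := by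
  classical
  induction S using Finset.induction_on with
  | empty => simp [convPoly]
  | insert j S hj ih =>
    have key : momentMap (convPoly (thetaSeries τ m μ (insert j S))) ∘ₗ
          LinearMap.mulLeft K (X - C (μ j)) =
        LinearMap.mulLeft K (X - C (μ j - τ * m j)) ∘ₗ
          momentMap (convPoly (thetaSeries τ m μ S)) +
        (Algebra.linearMap K K[X]) ∘ₗ thetaFunctional τ m μ S := by
      refine linearMap_ext_X_pow fun n => ?_
      have h : ∀ n, convPoly (thetaSeries τ m μ (insert j S)) (n + 1) -
            C (μ j) * convPoly (thetaSeries τ m μ (insert j S)) n =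
          (X - C (μ j - τ * m j)) * convPoly (thetaSeries τ m μ S) n +
            C (PowerSeries.coeff (n + 1) (thetaSeries τ m μ S)) := by
        intro n
        induction n with
        | zero =>
          have h0 := congrArg C (coeff_thetaSeries_insert τ m μ hj 0)
          simp only [coeff_zero_thetaSeries, map_sub, map_mul, mul_one] at h0
          rw [convPoly_succ]
          simp only [convPoly, Finset.Nat.antidiagonal_zero, Finset.sum_singleton,
            coeff_zero_thetaSeries, map_sub, map_mul, C_1, zero_add, pow_zero]
          linear_combination h0
        | succ n ihn =>
          have h1 := congrArg C (coeff_thetaSeries_insert τ m μ hj (n + 1))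
          simp only [map_sub, map_mul] at h1 ihn ⊢
          have e := convPoly_succ (thetaSeries τ m μ (insert j S)) n
          have e' := convPoly_succ (thetaSeries τ m μ (insert j S)) (n + 1)
          have e'' := convPoly_succ (thetaSeries τ m μ S) n
          linear_combination X * ihn + h1 + e' - C (μ j) * e -
            (X - (C (μ j) - C τ * C (m j : K))) * e''
      simpa only [LinearMap.comp_apply, LinearMap.mulLeft_apply, LinearMap.add_apply,
        sub_mul, ← pow_succ', ← smul_eq_C_mul, map_sub, map_smul, thetaFunctional,
        momentMap_X_pow, Algebra.linearMap_apply, Polynomial.algebraMap_eq] using h n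
    have h := LinearMap.congr_fun key (∏ j ∈ S, (X - C (μ j)))
    have h0 := thetaFunctional_prod_mul τ m μ S 1
    rw [mul_one] at h0
    simpa [Finset.prod_insert hj, ih, h0] using h

lemma thetaSeries_mul_thetaSeries (μ : ι → K) (S : Finset ι) :
    thetaSeries τ m μ S * thetaSeries (-τ) m (fun j => μ j - τ * m j) S = 1 := by
  rw [thetaSeries, thetaSeries, ← Finset.prod_mul_distrib]
  refine Finset.prod_eq_one fun j _ => ?_
  have h1 := one_sub_mul_thetaFactor (μ j) (τ * m j)
  have h2 := one_sub_mul_thetaFactor (μ j - τ * m j) (-τ * m j)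
  have h3 := one_sub_mul_geometric (μ j)
  have h4 : μ j - τ * m j - -τ * m j = μ j := by ring
  rw [h4] at h2
  linear_combination
    ((1 + PowerSeries.C (τ * m j) * (PowerSeries.X * PowerSeries.mk fun d => μ j ^ d)) *
      (1 + PowerSeries.C (-τ * m j) *
        (PowerSeries.X * PowerSeries.mk fun d => (μ j - τ * m j) ^ d)) - 1) * (-h3)
    + (PowerSeries.mk fun d => μ j ^ d) * (h2 + (1 + PowerSeries.C (-τ * m j) *
        (PowerSeries.X * PowerSeries.mk fun d => (μ j - τ * m j) ^ d)) * h1)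

lemma coeff_succ_thetaSeries {k : ℕ} (m : Fin k → ℕ) (μ : Fin k → K) (ℓ : ℕ) :
    PowerSeries.coeff (ℓ + 1) (thetaSeries τ m μ Finset.univ) = τ * theta m μ τ ℓ := by
  have hprod : ∀ s, ∀ J ∈ Finset.powersetCard s (Finset.univ : Finset (Fin k)),
      ∏ j ∈ J, (PowerSeries.C (τ * (m j : K)) *
        (PowerSeries.X * PowerSeries.mk fun d => μ j ^ d)) =
      PowerSeries.C (τ ^ s * ∏ j ∈ J, (m j : K)) *
        (PowerSeries.X ^ s * ∏ j ∈ J, PowerSeries.mk fun d => μ j ^ d) := by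
    intro s J hJ
    rw [Finset.mem_powersetCard] at hJ
    simp [Finset.prod_mul_distrib, hJ.2, map_prod]
  rw [thetaSeries, Finset.prod_one_add, Finset.sum_powerset, map_sum, Finset.sum_range_succ',
    theta, Finset.mul_sum, Finset.card_univ, Fintype.card_fin]
  have h0 : PowerSeries.coeff (ℓ + 1) (∑ J ∈ Finset.powersetCard 0 (Finset.univ : Finset (Fin k)),
      ∏ j ∈ J, (PowerSeries.C (τ * (m j : K)) *
        (PowerSeries.X * PowerSeries.mk fun d => μ j ^ d))) = 0 := by
    simp [PowerSeries.coeff_one]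
  rw [h0, add_zero, Finset.range_eq_Ico, Finset.sum_Ico_add' (fun s => PowerSeries.coeff (ℓ + 1)
    (∑ J ∈ Finset.powersetCard s (Finset.univ : Finset (Fin k)),
      ∏ j ∈ J, (PowerSeries.C (τ * (m j : K)) *
        (PowerSeries.X * PowerSeries.mk fun d => μ j ^ d)))) 0 k 1, zero_add]
  refine Finset.sum_congr (by ext; simp) fun s hs => ?_
  have hs1 : 1 ≤ s := (Finset.mem_Icc.1 hs).1
  rw [Finset.sum_congr rfl (hprod s), map_sum]
  simp only [PowerSeries.coeff_C_mul, PowerSeries.coeff_X_pow_mul', PowerSeries.coeff_prod,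
    PowerSeries.coeff_mk]
  split_ifs with h
  · rw [← mul_assoc, ← pow_succ', Nat.sub_add_cancel hs1, Finset.mul_sum]
    simp only [mul_assoc]
  · simp

end ThetaSeries

section ThetaConvolution

variable {K : Type*} [CommRing K]

lemma theta_eq_sum_antidiagonal [IsDomain K] {τ : K} (hτ : τ ≠ 0) {k : ℕ} (m : Fin k → ℕ)
    (μ : Fin k → K) (ℓ : ℕ) :
    theta m μ τ ℓ = ∑ p ∈ Finset.HasAntidiagonal.antidiagonal ℓ,
      PowerSeries.coeff p.1 (thetaSeries τ m μ Finset.univ) *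
        theta m (fun j => μ j - τ * m j) (-τ) p.2 := by
  have h := congrArg (PowerSeries.coeff (ℓ + 1))
    (thetaSeries_mul_thetaSeries τ m μ (Finset.univ : Finset (Fin k)))
  rw [PowerSeries.coeff_mul, Finset.Nat.sum_antidiagonal_succ'] at h
  simp only [coeff_succ_thetaSeries, coeff_zero_thetaSeries, PowerSeries.coeff_one,
    Nat.succ_ne_zero, if_false, mul_one] at h
  refine mul_left_cancel₀ hτ ?_
  rw [eq_neg_of_add_eq_zero_left h, Finset.mul_sum, ← Finset.sum_neg_distrib]
  exact Finset.sum_congr rfl fun p _ => by ring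

lemma theta_zero_s10 [IsDomain K] {τ : K} (hτ : τ ≠ 0) {k : ℕ} (m : Fin k → ℕ) (μ : Fin k → K) :
    theta m μ τ 0 = ∑ j, (m j : K) := by
  have h := thetaFunctional_one τ m μ Finset.univ
  rw [thetaFunctional, momentMap_one, coeff_succ_thetaSeries] at h
  exact mul_left_cancel₀ hτ h

lemma momentMap_theta_comp_X_sub_C [IsDomain K] {τ : K} (hτ : τ ≠ 0) {k : ℕ} (m : Fin k → ℕ)
    (μ : Fin k → K) (c : K) (ℓ : ℕ) :
    momentMap (theta m μ τ) ((X - C c) ^ ℓ) = theta m (fun j => μ j - c) τ ℓ := by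
  have hF : ∀ (μ : Fin k → K) (f : K[X]), thetaFunctional τ m μ Finset.univ f =
      τ * momentMap (theta m μ τ) f := by
    intro μ f
    have := map_momentMap (LinearMap.mulLeft K τ) (theta m μ τ) f
    simp only [LinearMap.mulLeft_apply, ← coeff_succ_thetaSeries] at this
    exact this.symm
  have h := thetaFunctional_comp_X_add_C τ m μ Finset.univ (-c) (X ^ ℓ)
  rw [hF, hF, momentMap_X_pow] at h
  simpa [sub_eq_add_neg] using mul_left_cancel₀ hτ h

lemma eq_of_antidiagonal_sum_eq {M : Type*} [AddCommGroup M] [Module K M] {T : PowerSeries K}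
    (hT : PowerSeries.coeff 0 T = 1) {y z : ℕ → M} {k : ℕ}
    (h : ∀ ℓ < k, ∑ p ∈ Finset.HasAntidiagonal.antidiagonal ℓ, PowerSeries.coeff p.1 T • y p.2 =
      ∑ p ∈ Finset.HasAntidiagonal.antidiagonal ℓ, PowerSeries.coeff p.1 T • z p.2) :
    ∀ ℓ < k, y ℓ = z ℓ := by
  intro ℓ
  induction ℓ using Nat.strong_induction_on with
  | _ ℓ ih =>
    intro hℓ
    have h' := h ℓ hℓ
    have hmem : (0, ℓ) ∈ Finset.HasAntidiagonal.antidiagonal ℓ := by simp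
    rw [← Finset.add_sum_erase _ _ hmem, ← Finset.add_sum_erase _ _ hmem] at h'
    have hrest : ∀ p ∈ (Finset.HasAntidiagonal.antidiagonal ℓ).erase (0, ℓ),
        PowerSeries.coeff p.1 T • y p.2 = PowerSeries.coeff p.1 T • z p.2 := by
      rintro ⟨i, j⟩ hp
      have hne : ¬(i = 0 ∧ j = ℓ) := by simpa using (Finset.mem_erase.1 hp).1
      have hij : i + j = ℓ := by simpa using (Finset.mem_erase.1 hp).2
      rw [ih j (by omega) (by omega)]
    rw [Finset.sum_congr rfl hrest] at h'
    simpa [hT] using add_right_cancel h'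

end ThetaConvolution

section TracePowers

variable {K R ι : Type*} [CommRing K] [Ring R] [Algebra K R] [Fintype ι] [DecidableEq ι]

/-- A sequence of matrices obeying the recursion satisfied by the powers of the matrix of
generators in the convention opposite to that of matrix multiplication. -/
structure IsOppositePowers (τ : K) (Y : Matrix ι ι R) (A : ℕ → Matrix ι ι R) : Prop where
  zero : A 0 = 1
  succ (ℓ : ℕ) : A (ℓ + 1) = A ℓ * Y + τ • Matrix.diagonal fun _ => (A ℓ).trace

lemma trace_aeval (Y : Matrix ι ι R) (f : K[X]) :
    (aeval Y f).trace = momentMap (fun ℓ => (Y ^ ℓ).trace) f := by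
  have h := LinearMap.congr_fun (linearMap_eq_momentMap
    (Matrix.traceLinearMap ι K R ∘ₗ (aeval Y).toLinearMap)) f
  simpa using h

lemma trace_pow_sub_algebraMap [IsDomain K] {τ : K} (hτ : τ ≠ 0) {k : ℕ} {m : Fin k → ℕ}
    {μ : Fin k → K} {E : Matrix ι ι R} (c : K)
    (h : ∀ ℓ < k, (E ^ ℓ).trace = algebraMap K R (theta m μ τ ℓ)) :
    ∀ ℓ < k, ((E - algebraMap K _ c) ^ ℓ).trace =
      algebraMap K R (theta m (fun j => μ j - c) τ ℓ) := by
  intro ℓ hℓ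
  have hE : (E - algebraMap K _ c) ^ ℓ = aeval E ((X - C c) ^ ℓ) := by simp
  have hdeg : ((X - C c) ^ ℓ : K[X]).natDegree < k := by
    refine lt_of_le_of_lt (Polynomial.natDegree_pow_le_of_le ℓ (Polynomial.natDegree_X_sub_C_le c)) ?_
    omega
  rw [hE, trace_aeval, momentMap_congr hdeg h, ← momentMap_theta_comp_X_sub_C hτ]
  exact (map_momentMap (Algebra.linearMap K R) _ _).symm

variable {τ : K} {Y : Matrix ι ι R} {A : ℕ → Matrix ι ι R} {k : ℕ} {m : Fin k → ℕ}
  {μ : Fin k → K}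

lemma IsOppositePowers.eq_aeval (hA : IsOppositePowers τ Y A) (L : ℕ)
    (h : ∀ i < L, (A i).trace = algebraMap K R (theta m μ τ i)) :
    A L = aeval Y (convPoly (thetaSeries τ m μ Finset.univ) L) := by
  induction L with
  | zero => simp [hA.zero, convPoly]
  | succ L ih =>
    rw [hA.succ, ih fun i hi => h i (by omega), ← ih fun i hi => h i (by omega),
      h L L.lt_succ_self, convPoly_succ, coeff_succ_thetaSeries, map_add, map_mul, aeval_X, aeval_C,
      ih fun i hi => h i (by omega)]
    congr 1
    rw [Algebra.algebraMap_eq_smul_one (τ * _), mul_smul, ← Algebra.algebraMap_eq_smul_one,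
      Matrix.algebraMap_eq_diagonal]
    rfl

lemma trace_aeval_convPoly (T : PowerSeries K) (ℓ : ℕ) :
    (aeval Y (convPoly T ℓ)).trace =
      ∑ p ∈ Finset.HasAntidiagonal.antidiagonal ℓ,
        PowerSeries.coeff p.1 T • (Y ^ p.2).trace := by
  simp [convPoly, ← smul_eq_C_mul, Matrix.trace_sum, Matrix.trace_smul]

lemma algebraMap_theta_eq_sum [IsDomain K] (hτ : τ ≠ 0) (m : Fin k → ℕ)
    (μ : Fin k → K) (ℓ : ℕ) :
    algebraMap K R (theta m μ τ ℓ) = ∑ p ∈ Finset.HasAntidiagonal.antidiagonal ℓ,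
      PowerSeries.coeff p.1 (thetaSeries τ m μ Finset.univ) •
        algebraMap K R (theta m (fun j => μ j - τ * m j) (-τ) p.2) := by
  simp [theta_eq_sum_antidiagonal hτ m μ ℓ, Algebra.smul_def]

lemma IsOppositePowers.trace_eq_iff [IsDomain K] (hτ : τ ≠ 0) (hA : IsOppositePowers τ Y A) :
    (∀ ℓ < k, (A ℓ).trace = algebraMap K R (theta m μ τ ℓ)) ↔
      ∀ ℓ < k, (Y ^ ℓ).trace =
        algebraMap K R (theta m (fun j => μ j - τ * m j) (-τ) ℓ) := by
  constructor
  · intro h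
    refine eq_of_antidiagonal_sum_eq (coeff_zero_thetaSeries τ m μ Finset.univ) fun ℓ hℓ => ?_
    rw [← algebraMap_theta_eq_sum hτ, ← h ℓ hℓ,
      hA.eq_aeval ℓ fun i hi => h i (hi.trans hℓ), trace_aeval_convPoly]
  · intro h ℓ
    induction ℓ using Nat.strong_induction_on with
    | _ ℓ ih =>
      intro hℓ
      rw [hA.eq_aeval ℓ fun i hi => ih i hi (hi.trans hℓ), trace_aeval_convPoly,
        algebraMap_theta_eq_sum hτ]
      refine Finset.sum_congr rfl fun p hp => ?_
      rw [h p.2 (by have := Finset.HasAntidiagonal.mem_antidiagonal.1 hp; omega)]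

lemma IsOppositePowers.momentMap_prod (hA : IsOppositePowers τ Y A)
    (h : ∀ ℓ < k, (A ℓ).trace = algebraMap K R (theta m μ τ ℓ)) :
    momentMap A (∏ j, (X - C (μ j))) = aeval Y (∏ j, (X - C (μ j - τ * m j))) := by
  have hdeg : (∏ j, (X - C (μ j))).natDegree < k + 1 := by
    nontriviality K
    simp [Polynomial.natDegree_prod_of_monic _ _ fun j _ => Polynomial.monic_X_sub_C (μ j)]
  rw [momentMap_congr hdeg fun i hi => hA.eq_aeval (m := m) (μ := μ) i fun j hj => h j (by omega),
    ← momentMap_convPoly_thetaSeries]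
  exact (map_momentMap (aeval Y).toLinearMap _ _).symm

end TracePowers

section Generators

variable {K S R : Type*} [CommRing K] [Ring S] [Algebra K S] [Ring R] [Algebra K R] {n k : ℕ}

/-- The entries of `e` satisfy the commutation relations of matrix units scaled by `τ`. -/
def HasGlCommutator (τ : K) (e : Matrix (Fin n) (Fin n) S) : Prop :=
  ∀ i j p q : Fin n, e i j * e p q - e p q * e i j =
    τ • ((if j = p then e i q else 0) - (if i = q then e p j else 0))

/-- The matrix `E ^ ℓ`, with entries
`(E ^ ℓ)^i_j = Σ E^{α₁}_j E^{α₂}_{α₁} ⋯ E^i_{α_{ℓ-1}}`. -/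
def oppositePow (e : Matrix (Fin n) (Fin n) S) (ℓ : ℕ) : Matrix (Fin n) (Fin n) S :=
  Matrix.of fun i j => unop ((e.map op ^ ℓ) i j)

variable {τ : K} {e : Matrix (Fin n) (Fin n) S}

lemma oppositePow_zero (e : Matrix (Fin n) (Fin n) S) : oppositePow e 0 = 1 := by
  ext i j
  simp only [oppositePow, pow_zero, Matrix.of_apply, Matrix.one_apply]
  split_ifs <;> simp

lemma oppositePow_succ_apply (ℓ : ℕ) (i j : Fin n) :
    oppositePow e (ℓ + 1) i j = ∑ a, e a j * oppositePow e ℓ i a := by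
  simp [oppositePow, pow_succ, Matrix.mul_apply, Finset.unop_sum]

lemma HasGlCommutator.commutator_oppositePow (he : HasGlCommutator τ e) (ℓ : ℕ) (i j p q : Fin n) :
    e i j * oppositePow e ℓ p q - oppositePow e ℓ p q * e i j =
      τ • ((if j = p then oppositePow e ℓ i q else 0) -
        (if i = q then oppositePow e ℓ p j else 0)) := by
  induction ℓ generalizing p q with
  | zero =>
    simp only [oppositePow_zero, Matrix.one_apply]
    by_cases hjp : j = p <;> by_cases hiq : i = q <;> by_cases hpq : p = q <;>
      simp [hjp, hiq, hpq, eq_comm]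
  | succ ℓ ih =>
    have hterm : ∀ a, e i j * (e a q * oppositePow e ℓ p a) -
        e a q * oppositePow e ℓ p a * e i j =
        τ • (((if j = a then e i q else 0) -
          (if i = q then e a j else 0)) * oppositePow e ℓ p a) +
        τ • (e a q * ((if j = p then oppositePow e ℓ i a else 0) -
          (if i = a then oppositePow e ℓ p j else 0))) := by
      intro a
      rw [← smul_mul_assoc, ← mul_smul_comm, ← ih, ← he]
      simp only [sub_mul, mul_sub, mul_assoc]
      abel
    rw [oppositePow_succ_apply, Finset.mul_sum, Finset.sum_mul, ← Finset.sum_sub_distrib,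
      Finset.sum_congr rfl fun a _ => hterm a, Finset.sum_add_distrib, ← Finset.smul_sum,
      ← Finset.smul_sum, ← smul_add]
    congr 1
    simp only [sub_mul, mul_sub, Finset.sum_sub_distrib, ite_mul, mul_ite, zero_mul, mul_zero,
      Finset.sum_ite_eq, Finset.mem_univ, if_true]
    have sum_ite : ∀ (c : Prop) [Decidable c] (f : Fin n → S),
        ∑ a, (if c then f a else 0) = if c then ∑ a, f a else 0 := by
      intro c _ f
      split_ifs <;> simp
    rw [sum_ite, sum_ite, ← oppositePow_succ_apply, ← oppositePow_succ_apply]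
    abel

lemma HasGlCommutator.isOppositePowers (he : HasGlCommutator τ e) :
    IsOppositePowers τ (e - algebraMap K _ ((n : K) * τ)) (oppositePow e) where
  zero := oppositePow_zero e
  succ ℓ := by
    ext i j
    have hterm : ∀ a, e a j * oppositePow e ℓ i a =
        oppositePow e ℓ i a * e a j +
        τ • ((if j = i then oppositePow e ℓ a a else 0) - oppositePow e ℓ i j) := by
      intro a
      have h := he.commutator_oppositePow ℓ a j i a
      rw [if_pos rfl] at h
      rw [← h]
      abel
    rw [oppositePow_succ_apply, Finset.sum_congr rfl fun a _ => hterm a, Finset.sum_add_distrib,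
      ← Finset.smul_sum, Finset.sum_sub_distrib, mul_sub, ← Algebra.commutes,
      Algebra.algebraMap_eq_smul_one, smul_mul_assoc, one_mul, Matrix.add_apply, Matrix.sub_apply,
      Matrix.mul_apply, Matrix.smul_apply, Matrix.smul_apply, Matrix.diagonal_apply]
    simp only [Finset.sum_const, Finset.card_univ, Fintype.card_fin,
      smul_sub, mul_comm (n : K) τ, mul_smul, Nat.cast_smul_eq_nsmul]
    by_cases hij : i = j
    · subst hij
      simp only [if_true, Matrix.trace, Matrix.diag_apply]
      abel
    · simp only [hij, Ne.symm hij, if_false, Finset.sum_const_zero, smul_zero]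
      abel

lemma unop_trace_map_op_pow (e : Matrix (Fin n) (Fin n) S) (ℓ : ℕ) :
    unop (Matrix.trace (e.map op ^ ℓ)) = (oppositePow e ℓ).trace := by
  simp [oppositePow, Matrix.trace, Finset.unop_sum]

lemma prod_ofFn_sub_algebraMap {B : Type*} [Ring B] [Algebra K B] (b : B) (μ : Fin k → K) :
    (List.ofFn fun s => b - algebraMap K B (μ s)).prod = aeval b (∏ s, (X - C (μ s))) := by
  rw [← List.prod_ofFn, map_list_prod, List.map_ofFn]
  congr 2
  ext s
  simp

lemma unop_aeval_map_op_apply (e : Matrix (Fin n) (Fin n) S) (f : K[X]) (i j : Fin n) :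
    unop (aeval (e.map op) f i j) = momentMap (oppositePow e) f i j := by
  let entry : Matrix (Fin n) (Fin n) Sᵐᵒᵖ →ₗ[K] S :=
    (MulOpposite.opLinearEquiv K).symm.toLinearMap ∘ₗ Matrix.entryLinearMap K _ i j
  have h := LinearMap.congr_fun (linearMap_eq_momentMap
    (entry ∘ₗ (aeval (e.map op)).toLinearMap)) f
  refine Eq.trans h (Eq.trans ?_ (map_momentMap (Matrix.entryLinearMap K S i j) _ f).symm)
  congr 2
  ext ℓ
  simp [entry, oppositePow]

lemma IsOppositePowers.mapMatrix {Y : Matrix (Fin n) (Fin n) S}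
    {A : ℕ → Matrix (Fin n) (Fin n) S} (hA : IsOppositePowers τ Y A) (φ : S →ₐ[K] R) :
    IsOppositePowers τ (φ.mapMatrix Y) fun ℓ => φ.mapMatrix (A ℓ) where
  zero := by simp [hA.zero]
  succ ℓ := by
    rw [hA.succ, map_add, map_mul, map_smul]
    congr 2
    simp [Matrix.diagonal_map, AddMonoidHom.map_trace]

lemma trace_mapMatrix (φ : S →ₐ[K] R) (M : Matrix (Fin n) (Fin n) S) :
    (φ.mapMatrix M).trace = φ M.trace := by
  simp [Matrix.trace]

/-- The generators of `I_{m,μ,τ}` in an arbitrary algebra with a matrix `e` of elements. -/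
def oppositeGenSet (τ : K) (e : Matrix (Fin n) (Fin n) S) (m : Fin k → ℕ) (μ : Fin k → K) :
    Set S :=
  {u | ∃ i j : Fin n, u = unop ((List.ofFn fun s : Fin k =>
    e.map op - algebraMap K (Matrix (Fin n) (Fin n) Sᵐᵒᵖ) (μ s)).prod i j)} ∪
  {u | ∃ ℓ ∈ Finset.Icc 1 (k - 1),
    u = unop (Matrix.trace (e.map op ^ ℓ)) - algebraMap K S (theta m μ τ ℓ)}

/-- The generators of `I°_{m,ν,τ}` in an arbitrary algebra with a matrix `e` of elements. -/
def standardGenSet (τ : K) (e : Matrix (Fin n) (Fin n) S) (m : Fin k → ℕ) (ν : Fin k → K) :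
    Set S :=
  {u | ∃ i j : Fin n, u = (List.ofFn fun s : Fin k =>
    e - algebraMap K (Matrix (Fin n) (Fin n) S) (ν s)).prod i j} ∪
  {u | ∃ ℓ ∈ Finset.Icc 1 (k - 1),
    u = Matrix.trace (e ^ ℓ) - algebraMap K S (theta m ν (-τ) ℓ)}

theorem HasGlCommutator.forall_genSet_iff [IsDomain K] (hτ : τ ≠ 0) (he : HasGlCommutator τ e)
    {m : Fin k → ℕ} (hsum : ∑ i, m i = n)
    {μ ν : Fin k → K} (hν : ∀ i, ν i = μ i + ((n - m i : ℕ) : K) * τ) (φ : S →ₐ[K] R) :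
    (∀ u ∈ oppositeGenSet τ e m μ, φ u = 0) ↔ ∀ u ∈ standardGenSet τ e m ν, φ u = 0 := by
  have hν' : ∀ i, ν i - (n : K) * τ = μ i - τ * m i := by
    intro i
    have hi : m i ≤ n := hsum ▸ Finset.single_le_sum (fun _ _ => Nat.zero_le _) (Finset.mem_univ i)
    rw [hν, Nat.cast_sub hi]
    ring
  have hA := he.isOppositePowers.mapMatrix φ
  rw [map_sub, AlgHom.commutes] at hA
  have hcast : algebraMap K R (∑ j, (m j : K)) = n := by
    rw [← Nat.cast_sum, hsum, map_natCast]
  have htrA : (∀ ℓ ∈ Finset.Icc 1 (k - 1),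
        φ (unop (Matrix.trace (e.map op ^ ℓ)) - algebraMap K S (theta m μ τ ℓ)) = 0) ↔
      ∀ ℓ < k, (φ.mapMatrix (oppositePow e ℓ)).trace = algebraMap K R (theta m μ τ ℓ) := by
    simp only [map_sub, AlgHom.commutes, sub_eq_zero, unop_trace_map_op_pow, trace_mapMatrix]
    refine ⟨fun h ℓ hℓ => ?_, fun h ℓ hℓ => h ℓ (by have := Finset.mem_Icc.1 hℓ; omega)⟩
    rcases Nat.eq_zero_or_pos ℓ with rfl | h0
    · simp [oppositePow_zero, theta_zero_s10 hτ, -map_sum, hcast]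
    · exact h ℓ (Finset.mem_Icc.2 ⟨h0, by omega⟩)
  have htrAop : (∀ ℓ ∈ Finset.Icc 1 (k - 1),
        φ (Matrix.trace (e ^ ℓ) - algebraMap K S (theta m ν (-τ) ℓ)) = 0) ↔
      ∀ ℓ < k, (φ.mapMatrix e ^ ℓ).trace = algebraMap K R (theta m ν (-τ) ℓ) := by
    simp only [map_sub, AlgHom.commutes, sub_eq_zero, ← map_pow, trace_mapMatrix]
    refine ⟨fun h ℓ hℓ => ?_, fun h ℓ hℓ => h ℓ (by have := Finset.mem_Icc.1 hℓ; omega)⟩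
    rcases Nat.eq_zero_or_pos ℓ with rfl | h0
    · simp [theta_zero_s10 (neg_ne_zero.2 hτ), -map_sum, hcast]
    · exact h ℓ (Finset.mem_Icc.2 ⟨h0, by omega⟩)
  have hshift : (∀ ℓ < k, (φ.mapMatrix e ^ ℓ).trace =
        algebraMap K R (theta m ν (-τ) ℓ)) ↔
      ∀ ℓ < k, ((φ.mapMatrix e - algebraMap K _ ((n : K) * τ)) ^ ℓ).trace =
        algebraMap K R (theta m (fun j => μ j - τ * m j) (-τ) ℓ) := by
    simp only [← hν']
    refine ⟨trace_pow_sub_algebraMap (neg_ne_zero.2 hτ) _, fun h => ?_⟩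
    simpa using trace_pow_sub_algebraMap (neg_ne_zero.2 hτ) (-((n : K) * τ)) h
  have htr := (htrA.trans (hA.trace_eq_iff hτ)).trans (hshift.symm.trans htrAop.symm)
  have hprod : (∀ ℓ ∈ Finset.Icc 1 (k - 1),
        φ (unop (Matrix.trace (e.map op ^ ℓ)) - algebraMap K S (theta m μ τ ℓ)) = 0) →
      ∀ i j, φ (unop ((List.ofFn fun s : Fin k =>
          e.map op - algebraMap K (Matrix (Fin n) (Fin n) Sᵐᵒᵖ) (μ s)).prod i j)) =
        φ ((List.ofFn fun s : Fin k =>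
          e - algebraMap K (Matrix (Fin n) (Fin n) S) (ν s)).prod i j) := by
    intro h i j
    have h1 := hA.momentMap_prod (htrA.1 h)
    have h2 := map_momentMap φ.mapMatrix.toLinearMap (oppositePow e) (∏ s, (X - C (μ s)))
    have h3 : aeval (φ.mapMatrix e - algebraMap K _ ((n : K) * τ))
        (∏ j, (X - C (μ j - τ * (m j : K)))) =
        φ.mapMatrix (aeval e (∏ s, (X - C (ν s)))) := by
      rw [← Polynomial.aeval_algHom_apply, ← prod_ofFn_sub_algebraMap,
        ← prod_ofFn_sub_algebraMap]
      simp [← hν']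
    rw [prod_ofFn_sub_algebraMap, prod_ofFn_sub_algebraMap, unop_aeval_map_op_apply]
    exact congrFun (congrFun (h2.trans (h1.trans h3)) i) j
  simp only [oppositeGenSet, standardGenSet, Set.mem_union, Set.mem_ofPred_eq, or_imp, forall_and]
  constructor
  · rintro ⟨h1, h2⟩
    have h2' := fun ℓ hℓ => h2 _ ⟨ℓ, hℓ, rfl⟩
    refine ⟨?_, ?_⟩
    · rintro _ ⟨i, j, rfl⟩
      rw [← hprod h2' i j]
      exact h1 _ ⟨i, j, rfl⟩
    · rintro _ ⟨ℓ, hℓ, rfl⟩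
      exact htr.1 h2' ℓ hℓ
  · rintro ⟨h1, h2⟩
    have h2' := htr.2 fun ℓ hℓ => h2 _ ⟨ℓ, hℓ, rfl⟩
    refine ⟨?_, ?_⟩
    · rintro _ ⟨i, j, rfl⟩
      rw [hprod h2' i j]
      exact h1 _ ⟨i, j, rfl⟩
    · rintro _ ⟨ℓ, hℓ, rfl⟩
      exact h2' ℓ hℓ

end Generators

section Quotients

variable {K A : Type*} [CommRing K] [Ring A] [Algebra K A] {S T : Set A}

lemma span_le_span_of_forall_algHom
    (h : ∀ I : TwoSidedIdeal A, (∀ u ∈ T, RingCon.mkₐ K I.ringCon u = 0) →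
      ∀ u ∈ S, RingCon.mkₐ K I.ringCon u = 0) :
    TwoSidedIdeal.span S ≤ TwoSidedIdeal.span T := by
  have hmem : ∀ (I : TwoSidedIdeal A) (u : A), RingCon.mkₐ K I.ringCon u = 0 ↔ u ∈ I := by
    intro I u
    rw [TwoSidedIdeal.mem_iff]
    exact (RingCon.eq I.ringCon)
  refine TwoSidedIdeal.span_le.2 fun u hu => ?_
  exact (hmem _ u).1 (h _ (fun v hv => (hmem _ v).2 (TwoSidedIdeal.subset_span hv)) u hu)

lemma mkAlgHom_eq_zero_of_mem {u : A} (hu : u ∈ S) :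
    RingQuot.mkAlgHom K (fun a b : A => a - b ∈ S) u = 0 := by
  have h : u - 0 ∈ S := by simpa using hu
  rw [RingQuot.mkAlgHom_rel K (s := fun a b : A => a - b ∈ S) (x := u) (y := 0) h, map_zero]

lemma nonempty_ringQuot_algEquiv
    (hS : ∀ u ∈ S, RingQuot.mkAlgHom K (fun a b : A => a - b ∈ T) u = 0)
    (hT : ∀ u ∈ T, RingQuot.mkAlgHom K (fun a b : A => a - b ∈ S) u = 0) :
    Nonempty (RingQuot (fun a b : A => a - b ∈ S) ≃ₐ[K] RingQuot (fun a b : A => a - b ∈ T)) := by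
  refine ⟨AlgEquiv.ofAlgHom
    (RingQuot.liftAlgHom K ⟨RingQuot.mkAlgHom K _, fun x y hxy => ?_⟩)
    (RingQuot.liftAlgHom K ⟨RingQuot.mkAlgHom K _, fun x y hxy => ?_⟩) ?_ ?_⟩
  · exact sub_eq_zero.1 (by rw [← map_sub]; exact hS _ hxy)
  · exact sub_eq_zero.1 (by rw [← map_sub]; exact hT _ hxy)
  · refine RingQuot.ringQuot_ext' K _ _ (AlgHom.ext fun x => ?_)
    simp
  · refine RingQuot.ringQuot_ext' K _ _ (AlgHom.ext fun x => ?_)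
    simp

end Quotients

lemma hasGlCommutator_Emat (n : ℕ) : HasGlCommutator (X : Ct) (Emat n) := by
  intro i j p q
  have h := RingQuot.mkAlgHom_rel Ct (glRel.comm i j q p)
  simp only [ite_smul, one_smul, zero_smul] at h
  have h' : RingQuot.mkAlgHom Ct (glRel n) ((X : Ct) •
      ((if j = p then FreeAlgebra.ι Ct (i, q) else 0) -
        (if i = q then FreeAlgebra.ι Ct (p, j) else 0))) =
      (X : Ct) • ((if j = p then Emat n i q else 0) - (if i = q then Emat n p j else 0)) := by
    rw [map_smul, map_sub, apply_ite (RingQuot.mkAlgHom Ct (glRel n)),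
      apply_ite (RingQuot.mkAlgHom Ct (glRel n)), map_zero]
    rfl
  rw [← h', ← h, map_sub, map_mul, map_mul]
  rfl

theorem forall_genSetA_iff_forall_genSetAop {n k : ℕ} {m : Fin k → ℕ} (hsum : ∑ i, m i = n)
    {μ ν : Fin k → Ct} (hν : ∀ i, ν i = μ i + ((n - m i : ℕ) : Ct) * X)
    {R : Type*} [Ring R] [Algebra Ct R] (φ : Ugt n →ₐ[Ct] R) :
    (∀ u ∈ genSetA n k m μ, φ u = 0) ↔ ∀ u ∈ genSetAop n k m ν, φ u = 0 :=
  (hasGlCommutator_Emat n).forall_genSet_iff X_ne_zero hsum hν φ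

/-- with `ν_i = μ_i + (n − m_i)t`, the two-sided ideals `I_{m,μ,t}` and
`I°_{m,ν,t}` coincide; consequently the identity on the generators induces an algebra
isomorphism `A_{m,μ,t} ≅ A°_{m,ν,t}`. -/
theorem statement10 (n k : ℕ) (hn : 1 ≤ n) (hk : 1 ≤ k) (hkn : k ≤ n)
    (m : Fin k → ℕ) (hm : ∀ i, 0 < m i) (hsum : ∑ i, m i = n)
    (μ : Fin k → ℂ)
    (ν : Fin k → Ct) (hν : ∀ i, ν i = C (μ i) + ((n - m i : ℕ) : Ct) * X) :
    IdealA n k m (fun i => C (μ i)) = IdealAop n k m ν ∧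
      Nonempty
        (AlgA n k m (fun i => C (μ i)) ≃ₐ[Ct] AlgAop n k m ν) := by
  constructor
  · refine le_antisymm (span_le_span_of_forall_algHom (K := Ct) fun I => ?_)
      (span_le_span_of_forall_algHom (K := Ct) fun I => ?_)
    · exact (forall_genSetA_iff_forall_genSetAop hsum hν _).2
    · exact (forall_genSetA_iff_forall_genSetAop hsum hν _).1
  · exact nonempty_ringQuot_algEquiv (K := Ct) (S := genSetA n k m fun i => C (μ i))
      (T := genSetAop n k m ν)
      ((forall_genSetA_iff_forall_genSetAop hsum hν _).2 fun _ hu => mkAlgHom_eq_zero_of_mem hu)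
      ((forall_genSetA_iff_forall_genSetAop hsum hν _).1 fun _ hu => mkAlgHom_eq_zero_of_mem hu)

end
end
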